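/- arXiv:1302.4164 — 3 statements merged into one kernel-verified Lean document; each statement's English description precedes it below -/
import Mathlib

section
/- For any nonincreasingly summed sequence of nonnegative reals a_1, ..., a_N and any real s ≥ 1, one has (∑_{i=1}^N a_i)^s ≤ s · ∑_{i=1}^N a_i · (∑_{j=i}^N a_j)^{s-1}. -/
open Finset

theorem add_rpow_le_mul_rpow_sub_one_add_rpow {x y s : ℝ} (hx : 0 ≤ x) (hy : 0 ≤ y)
    (hs : 1 ≤ s) : (x + y) ^ s ≤ s * (x * (x + y) ^ (s - 1)) + y ^ s := by
  rcases (add_nonneg hx hy).eq_or_lt with h | h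
  · obtain rfl : x = 0 := by linarith
    simp
  · have bernoulli : 1 + s * (y / (x + y) - 1) ≤ (1 + (y / (x + y) - 1)) ^ s :=
      one_add_mul_self_le_rpow_one_add (by linarith [div_nonneg hy h.le]) hs
    rw [add_sub_cancel, Real.div_rpow hy h.le, le_div_iff₀ (Real.rpow_pos_of_pos h s)]
      at bernoulli
    have hpow : (x + y) ^ s = (x + y) ^ (s - 1) * (x + y) := by
      rw [← Real.rpow_add_one h.ne', sub_add_cancel]
    have hmul : (1 + s * (y / (x + y) - 1)) * (x + y) ^ s =
        (x + y) ^ s - s * (x * (x + y) ^ (s - 1)) := by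
      rw [hpow]
      field_simp
      ring
    linarith

theorem elementary_tail_sum_inequality (N : ℕ) (a : Fin N → ℝ) (ha : ∀ i, 0 ≤ a i)
    (s : ℝ) (hs : 1 ≤ s) :
    (∑ i, a i) ^ s ≤
      s * ∑ i, a i * (∑ j ∈ Finset.univ.filter fun j => i ≤ j, a j) ^ (s - 1) := by
  induction N with
  | zero => simp [Real.zero_rpow (by linarith : s ≠ 0)]
  | succ n ih =>
    have htail := ih (fun i => a i.succ) fun i => ha i.succ
    have hhead := add_rpow_le_mul_rpow_sub_one_add_rpow (ha 0)
      (sum_nonneg fun i (_ : i ∈ univ) => ha (Fin.succ i)) hs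
    simp only [sum_filter] at htail ⊢
    simp only [Fin.sum_univ_succ, Fin.zero_le, if_true, Fin.succ_le_succ_iff, Fin.le_zero_iff,
      Fin.succ_ne_zero, if_false, zero_add, mul_add]
    linarith
end

section
/- Let σ be a locally finite Borel measure on ℝ^n, f ∈ L^p(dσ) nonnegative for some 1 < p < ∞, and let F be a collection of dyadic cubes F such that the sets E(F) = F \ ⋃{maximal dyadic Q ⊊ F with higher stopping average} are pairwise disjoint and satisfy σ(F) ≤ 2σ(E(F)). Then ∑_{F ∈ F} ((1/σ(F)) ∫_F f dσ)^p σ(F) ≤ 2 (p')^p ‖f‖_{L^p(dσ)}^p. -/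
open MeasureTheory ENNReal

noncomputable section

def dyadicCube (n : ℕ) (i : ℤ) (k : Fin n → ℤ) : Set (Fin n → ℝ) :=
  {x | ∀ j, (k j : ℝ) * 2 ^ (-i) ≤ x j ∧ x j < ((k j : ℝ) + 1) * 2 ^ (-i)}

def IsDyadicCube (n : ℕ) (Q : Set (Fin n → ℝ)) : Prop :=
  ∃ i k, Q = dyadicCube n i k

open scoped NNReal

theorem dyadicCube_eq_pi (n : ℕ) (i : ℤ) (k : Fin n → ℤ) :
    dyadicCube n i k =
      Set.univ.pi fun j => Set.Ico ((k j : ℝ) * 2 ^ (-i)) (((k j : ℝ) + 1) * 2 ^ (-i)) := by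
  ext x
  simp [dyadicCube]

theorem IsDyadicCube.measurableSet {n : ℕ} {Q : Set (Fin n → ℝ)} (hQ : IsDyadicCube n Q) :
    MeasurableSet Q := by
  obtain ⟨i, k, rfl⟩ := hQ
  rw [dyadicCube_eq_pi]
  exact MeasurableSet.univ_pi fun j => measurableSet_Ico

theorem IsDyadicCube.measure_lt_top {n : ℕ} {Q : Set (Fin n → ℝ)} (hQ : IsDyadicCube n Q)
    (σ : Measure (Fin n → ℝ)) [IsLocallyFiniteMeasure σ] : σ Q < ∞ := by
  obtain ⟨i, k, rfl⟩ := hQ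
  rw [dyadicCube_eq_pi]
  exact (measure_mono (Set.pi_mono fun j _ => Set.Ico_subset_Icc_self)).trans_lt
    (isCompact_univ_pi fun j => isCompact_Icc).measure_lt_top

theorem dyadicCube_subset_of_mem {n : ℕ} {i i' : ℤ} {k k' : Fin n → ℤ} (hi : i ≤ i')
    {x : Fin n → ℝ} (hx : x ∈ dyadicCube n i k) (hx' : x ∈ dyadicCube n i' k') :
    dyadicCube n i' k' ⊆ dyadicCube n i k := by
  intro y hy j
  obtain ⟨m, rfl⟩ := Int.le.dest hi
  have hscale : (2 : ℝ) ^ (-i) = ((2 ^ m : ℤ) : ℝ) * 2 ^ (-(i + m)) := by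
    push_cast
    rw [← zpow_natCast, ← zpow_add₀ two_ne_zero]
    congr 1
    ring
  have hpos : (0 : ℝ) < 2 ^ (-(i + m)) := by positivity
  obtain ⟨h1, h2⟩ := hx j
  obtain ⟨h3, h4⟩ := hx' j
  obtain ⟨h5, h6⟩ := hy j
  rw [hscale, ← mul_assoc] at h1 h2 ⊢
  have h7 : k j * 2 ^ m < k' j + 1 := by
    exact_mod_cast lt_of_mul_lt_mul_right (h1.trans_lt h4) hpos.le
  have h8 : k' j < (k j + 1) * 2 ^ m := by
    exact_mod_cast lt_of_mul_lt_mul_right (h3.trans_lt h2) hpos.le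
  have h9 : (k j : ℝ) * ((2 ^ m : ℤ) : ℝ) ≤ k' j := by exact_mod_cast Int.lt_add_one_iff.1 h7
  have h10 : (k' j : ℝ) + 1 ≤ ((k j : ℝ) + 1) * ((2 ^ m : ℤ) : ℝ) := by
    exact_mod_cast Int.add_one_le_iff.2 h8
  rw [← mul_assoc]
  exact ⟨(mul_le_mul_of_nonneg_right h9 hpos.le).trans h5,
    h6.trans_le (mul_le_mul_of_nonneg_right h10 hpos.le)⟩

theorem IsDyadicCube.subset_or_subset_or_disjoint {n : ℕ} {Q R : Set (Fin n → ℝ)}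
    (hQ : IsDyadicCube n Q) (hR : IsDyadicCube n R) : Q ⊆ R ∨ R ⊆ Q ∨ Disjoint Q R := by
  obtain ⟨i, k, rfl⟩ := hQ
  obtain ⟨i', k', rfl⟩ := hR
  by_cases hd : Disjoint (dyadicCube n i k) (dyadicCube n i' k')
  · exact Or.inr (Or.inr hd)
  obtain ⟨x, hx, hx'⟩ := Set.not_disjoint_iff.1 hd
  rcases le_total i i' with h | h
  · exact Or.inr (Or.inl (dyadicCube_subset_of_mem h hx hx'))
  · exact Or.inl (dyadicCube_subset_of_mem h hx' hx)

/-- For a finite nested family of sets, a density bound on each member passes to the union. -/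
theorem mul_measure_biUnion_le_of_nested {α : Type*} [MeasurableSpace α] (μ ν : Measure α)
    (T : Finset (Set α)) (c : ℝ≥0∞) (hmeas : ∀ Q ∈ T, MeasurableSet Q)
    (hnest : ∀ Q ∈ T, ∀ R ∈ T, Q ⊆ R ∨ R ⊆ Q ∨ Disjoint Q R)
    (hbound : ∀ Q ∈ T, c * μ Q ≤ ν Q) :
    c * μ (⋃ Q ∈ T, Q) ≤ ν (⋃ Q ∈ T, Q) := by
  classical
  set M := T.filter fun Q => Maximal (· ∈ T) Q with hM
  have hMT : ∀ Q ∈ M, Q ∈ T := fun Q hQ => (Finset.mem_filter.1 hQ).1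
  have hunion : ⋃ Q ∈ T, Q = ⋃ Q ∈ M, Q := by
    refine subset_antisymm (Set.iUnion₂_subset fun Q hQ => ?_)
      (Set.iUnion₂_subset fun Q hQ => Set.subset_biUnion_of_mem (u := id) (hMT Q hQ))
    obtain ⟨R, hQR, hR⟩ := T.exists_le_maximal hQ
    exact hQR.trans (Set.subset_biUnion_of_mem (u := id) (Finset.mem_filter.2 ⟨hR.prop, hR⟩))
  have hdisj : (M : Set (Set α)).PairwiseDisjoint fun Q => Q := by
    intro Q hQ R hR hne
    have hQ' := (Finset.mem_filter.1 (Finset.mem_coe.1 hQ)).2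
    have hR' := (Finset.mem_filter.1 (Finset.mem_coe.1 hR)).2
    rcases hnest Q hQ'.prop R hR'.prop with h | h | h
    · exact absurd (hQ'.eq_of_le hR'.prop h) hne
    · exact absurd (hR'.eq_of_le hQ'.prop h).symm hne
    · exact h
  rw [hunion, measure_biUnion_finset hdisj fun Q hQ => hmeas Q (hMT Q hQ),
    measure_biUnion_finset hdisj fun Q hQ => hmeas Q (hMT Q hQ), Finset.mul_sum]
  exact Finset.sum_le_sum fun Q hQ => hbound Q (hMT Q hQ)

/-- Integrated form of a weak-type inequality between two measures. -/
theorem lintegral_rpow_le_of_mul_measure_le {α : Type*} [MeasurableSpace α] (μ ν : Measure α)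
    {g : α → ℝ≥0} (hg : Measurable g) {p : ℝ} (hp : 1 < p)
    (hweak : ∀ t : ℝ≥0, t * μ {x | t < g x} ≤ ν {x | t < g x}) :
    ∫⁻ x, (g x : ℝ≥0∞) ^ p ∂μ ≤
      ENNReal.ofReal (p / (p - 1)) * ∫⁻ x, (g x : ℝ≥0∞) ^ (p - 1) ∂ν := by
  have hp0 : 0 < p := by linarith
  have hp1 : 0 < p - 1 := by linarith
  have hcake (κ : Measure α) {r : ℝ} (hr : 0 < r) : ∫⁻ x, (g x : ℝ≥0∞) ^ r ∂κ =
      ENNReal.ofReal r *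
        ∫⁻ t in Set.Ioi (0 : ℝ), κ {x | t < (g x : ℝ)} * ENNReal.ofReal (t ^ (r - 1)) := by
    rw [← lintegral_rpow_eq_lintegral_meas_lt_mul κ (f := fun x => (g x : ℝ))
      (Filter.Eventually.of_forall fun x => (g x).coe_nonneg)
      (hg.coe_nnreal_real.aemeasurable) hr]
    refine lintegral_congr fun x => ?_
    rw [← ENNReal.ofReal_rpow_of_nonneg (g x).coe_nonneg hr.le, ENNReal.ofReal_coe_nnreal]
  rw [hcake μ hp0, hcake ν hp1, ← mul_assoc, ← ENNReal.ofReal_mul (by positivity),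
    div_mul_cancel₀ _ hp1.ne']
  gcongr ENNReal.ofReal p * ?_
  refine setLIntegral_mono_ae' measurableSet_Ioi (Filter.Eventually.of_forall fun t ht => ?_)
  have ht : 0 < t := ht
  lift t to ℝ≥0 using ht.le
  have hsplit : ENNReal.ofReal ((t : ℝ) ^ (p - 1)) =
      t * ENNReal.ofReal ((t : ℝ) ^ (p - 1 - 1)) := by
    rw [← ENNReal.ofReal_coe_nnreal, ← ENNReal.ofReal_mul t.coe_nonneg,
      Real.rpow_sub_one ht.ne' (p - 1), mul_div_cancel₀ _ ht.ne']
  rw [hsplit, ← mul_assoc, mul_comm (μ _)]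
  simp only [NNReal.coe_lt_coe]
  gcongr
  exact hweak t

/-- A Doob-type `L^p` inequality: a weak-type bound localized to superlevel sets gives the
strong-type bound with the conjugate exponent as constant. -/
theorem lintegral_rpow_le_of_mul_measure_le_setLIntegral {α : Type*} [MeasurableSpace α]
    (μ : Measure α) {f : α → ℝ≥0∞} (hf : Measurable f) {g : α → ℝ≥0} (hg : Measurable g)
    {p : ℝ} (hp : 1 < p) (hfin : ∫⁻ x, (g x : ℝ≥0∞) ^ p ∂μ ≠ ∞)
    (hweak : ∀ t : ℝ≥0, t * μ {x | t < g x} ≤ ∫⁻ x in {x | t < g x}, f x ∂μ) :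
    ∫⁻ x, (g x : ℝ≥0∞) ^ p ∂μ ≤ ENNReal.ofReal ((p / (p - 1)) ^ p) * ∫⁻ x, f x ^ p ∂μ := by
  have hp0 : 0 < p := by linarith
  have hp1 : 0 < p - 1 := by linarith
  have hpq : p.HolderConjugate (p / (p - 1)) := Real.HolderConjugate.conjExponent hp
  set q := p / (p - 1) with hq
  have hq0 : 0 < q := div_pos hp0 hp1
  have hgc : Measurable fun x => (g x : ℝ≥0∞) := hg.coe_nnreal_ennreal
  have hmain := lintegral_rpow_le_of_mul_measure_le μ (μ.withDensity f) hg hp fun t => by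
    rw [withDensity_apply _ (measurableSet_lt measurable_const hg)]
    exact hweak t
  rw [lintegral_withDensity_eq_lintegral_mul μ hf (hgc.pow_const _)] at hmain
  have hholder := ENNReal.lintegral_mul_le_Lp_mul_Lq μ hpq hf.aemeasurable
    (hgc.pow_const (p - 1)).aemeasurable
  simp only [← ENNReal.rpow_mul, show (p - 1) * q = p by rw [hq]; field_simp] at hholder
  set A := ∫⁻ x, (g x : ℝ≥0∞) ^ p ∂μ with hA
  set B := ∫⁻ x, f x ^ p ∂μ with hB
  rcases eq_or_ne A 0 with hA0 | hA0
  · simp [hA0]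
  have hsum : 1 / p + 1 / q = 1 := by simpa using hpq.inv_add_inv_eq_one
  have hbound : A ^ (1 / p) * A ^ (1 / q) ≤
      (ENNReal.ofReal q * B ^ (1 / p)) * A ^ (1 / q) := by
    rw [← ENNReal.rpow_add _ _ hA0 hfin, hsum, ENNReal.rpow_one, mul_assoc]
    exact hmain.trans (by gcongr)
  have hroot : A ^ (1 / p) ≤ ENNReal.ofReal q * B ^ (1 / p) :=
    (ENNReal.mul_le_mul_iff_left (by simp [hA0, hfin])
      (ENNReal.rpow_ne_top_of_nonneg (by positivity) hfin)).1 hbound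
  have hpow := ENNReal.rpow_le_rpow hroot hp0.le
  rwa [ENNReal.mul_rpow_of_nonneg _ _ hp0.le, ← ENNReal.rpow_mul, ← ENNReal.rpow_mul,
    one_div_mul_cancel hp0.ne', ENNReal.rpow_one, ENNReal.rpow_one,
    ENNReal.ofReal_rpow_of_nonneg hq0.le hp0.le] at hpow

/-- The maximal function of a finite family of sets `S` with values `a`. -/
def finsetMaximal {α : Type*} (S : Finset (Set α)) (a : Set α → ℝ≥0) (x : α) : ℝ≥0 :=
  S.sup fun Q => Q.indicator (fun _ => a Q) x

section finsetMaximal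

variable {α : Type*} {S : Finset (Set α)} {a : Set α → ℝ≥0}

theorem le_finsetMaximal {Q : Set α} (hQ : Q ∈ S) {x : α} (hx : x ∈ Q) :
    a Q ≤ finsetMaximal S a x := by
  calc a Q = Q.indicator (fun _ => a Q) x := by rw [Set.indicator_of_mem hx]
    _ ≤ finsetMaximal S a x :=
      Finset.le_sup (f := fun Q : Set α => Q.indicator (fun _ => a Q) x) hQ

theorem setOf_lt_finsetMaximal (t : ℝ≥0) :
    {x | t < finsetMaximal S a x} = ⋃ Q ∈ S.filter (fun Q => t < a Q), Q := by
  ext x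
  simp only [finsetMaximal, Set.mem_ofPred_eq, Finset.lt_sup_iff, Set.mem_iUnion,
    Finset.mem_filter, exists_prop]
  refine exists_congr fun Q => ?_
  by_cases hx : x ∈ Q <;> simp [hx]

theorem measurable_finsetMaximal [MeasurableSpace α] (hS : ∀ Q ∈ S, MeasurableSet Q) :
    Measurable (finsetMaximal S a) := by
  refine measurable_of_Ioi fun t => ?_
  change MeasurableSet {x | t < finsetMaximal S a x}
  rw [setOf_lt_finsetMaximal]
  exact Finset.measurableSet_biUnion _ fun Q hQ => hS Q (Finset.mem_filter.1 hQ).1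

theorem lintegral_finsetMaximal_rpow_ne_top [MeasurableSpace α] {μ : Measure α}
    (hS : ∀ Q ∈ S, MeasurableSet Q) (hfin : ∀ Q ∈ S, μ Q ≠ ∞) {p : ℝ} (hp : 0 < p) :
    ∫⁻ x, (finsetMaximal S a x : ℝ≥0∞) ^ p ∂μ ≠ ∞ := by
  have hU : MeasurableSet (⋃ Q ∈ S, Q) := Finset.measurableSet_biUnion _ hS
  have hle : ∀ x, (finsetMaximal S a x : ℝ≥0∞) ^ p ≤
      (⋃ Q ∈ S, Q).indicator (fun _ => ((S.sup a : ℝ≥0) : ℝ≥0∞) ^ p) x := by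
    intro x
    by_cases hx : x ∈ ⋃ Q ∈ S, Q
    · rw [Set.indicator_of_mem hx]
      gcongr
      exact Finset.sup_mono_fun fun Q _ => Set.indicator_le_self' (fun _ _ => zero_le) x
    · have hzero : finsetMaximal S a x = 0 := by
        refine le_antisymm (Finset.sup_le fun Q hQ => ?_) zero_le
        rw [Set.indicator_of_notMem fun h => hx (Set.mem_biUnion hQ h)]
      simp [hzero, hp]
  refine ((lintegral_mono hle).trans_lt ?_).ne
  rw [lintegral_indicator_const hU]
  refine ENNReal.mul_lt_top (ENNReal.rpow_lt_top_of_nonneg hp.le ENNReal.coe_ne_top) ?_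
  exact measure_biUnion_lt_top S.finite_toSet fun Q hQ => (hfin Q hQ).lt_top

end finsetMaximal

theorem setLIntegral_ne_top_of_lintegral_rpow_ne_top {α : Type*} [MeasurableSpace α]
    {μ : Measure α} {f : α → ℝ≥0∞} {p : ℝ} (hp : 1 < p) {s : Set α}
    (hs : μ s ≠ ∞) (hfp : ∫⁻ x, f x ^ p ∂μ ≠ ∞) : ∫⁻ x in s, f x ∂μ ≠ ∞ := by
  have hle : ∀ x, f x ≤ 1 + f x ^ p := by
    intro x
    rcases le_total (f x) 1 with h | h
    · exact h.trans le_self_add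
    · calc f x = f x ^ (1 : ℝ) := (ENNReal.rpow_one _).symm
        _ ≤ f x ^ p := ENNReal.rpow_le_rpow_of_exponent_le h hp.le
        _ ≤ 1 + f x ^ p := le_add_self
  refine ((lintegral_mono hle).trans_lt ?_).ne
  rw [lintegral_add_left measurable_const, setLIntegral_one]
  exact ENNReal.add_lt_top.2 ⟨hs.lt_top, (setLIntegral_le_lintegral _ _).trans_lt hfp.lt_top⟩

/-- The dyadic maximal theorem, applied to a finite family with a disjoint system of large
subsets. -/
theorem sum_average_rpow_mul_measure_le {α : Type*} [MeasurableSpace α] (μ : Measure α)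
    {p : ℝ} (hp : 1 < p) {f : α → ℝ≥0∞} (hf : Measurable f) (hfp : ∫⁻ x, f x ^ p ∂μ ≠ ∞)
    (S : Finset (Set α)) (hmeas : ∀ Q ∈ S, MeasurableSet Q) (hfin : ∀ Q ∈ S, μ Q ≠ ∞)
    (hnest : ∀ Q ∈ S, ∀ R ∈ S, Q ⊆ R ∨ R ⊆ Q ∨ Disjoint Q R)
    (E : Set α → Set α) (hEsub : ∀ Q ∈ S, E Q ⊆ Q) (hEmeas : ∀ Q ∈ S, MeasurableSet (E Q))
    (hEdisj : (S : Set (Set α)).PairwiseDisjoint E) {C : ℝ≥0∞}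
    (hcar : ∀ Q ∈ S, μ Q ≤ C * μ (E Q)) :
    ∑ Q ∈ S, ((∫⁻ x in Q, f x ∂μ) / μ Q) ^ p * μ Q ≤
      C * ENNReal.ofReal ((p / (p - 1)) ^ p) * ∫⁻ x, f x ^ p ∂μ := by
  have hp0 : 0 < p := by linarith
  set a : Set α → ℝ≥0 := fun Q => ((∫⁻ x in Q, f x ∂μ) / μ Q).toNNReal with ha
  have haQ : ∀ Q ∈ S, μ Q ≠ 0 → (a Q : ℝ≥0∞) = (∫⁻ x in Q, f x ∂μ) / μ Q := fun Q hQ h0 =>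
    ENNReal.coe_toNNReal (ENNReal.div_ne_top
      (setLIntegral_ne_top_of_lintegral_rpow_ne_top hp (hfin Q hQ) hfp) h0)
  have hweak : ∀ t : ℝ≥0, t * μ {x | t < finsetMaximal S a x} ≤
      ∫⁻ x in {x | t < finsetMaximal S a x}, f x ∂μ := by
    intro t
    rw [← withDensity_apply f
      (measurableSet_lt measurable_const (measurable_finsetMaximal hmeas)),
      setOf_lt_finsetMaximal]
    have hS : ∀ Q ∈ S.filter (fun Q => t < a Q), Q ∈ S := fun Q hQ => (Finset.mem_filter.1 hQ).1
    refine mul_measure_biUnion_le_of_nested _ _ _ _ (fun Q hQ => hmeas Q (hS Q hQ))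
      (fun Q hQ R hR => hnest Q (hS Q hQ) R (hS R hR)) fun Q hQ => ?_
    rw [withDensity_apply f (hmeas Q (hS Q hQ))]
    rcases eq_or_ne (μ Q) 0 with h0 | h0
    · simp [h0]
    rw [← ENNReal.le_div_iff_mul_le (Or.inl h0) (Or.inl (hfin Q (hS Q hQ))),
      ← haQ Q (hS Q hQ) h0]
    exact_mod_cast (Finset.mem_filter.1 hQ).2.le
  have hterm : ∀ Q ∈ S, ((∫⁻ x in Q, f x ∂μ) / μ Q) ^ p * μ Q ≤
      C * ∫⁻ x in E Q, (finsetMaximal S a x : ℝ≥0∞) ^ p ∂μ := by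
    intro Q hQ
    rcases eq_or_ne (μ Q) 0 with h0 | h0
    · simp [h0]
    calc ((∫⁻ x in Q, f x ∂μ) / μ Q) ^ p * μ Q
        ≤ (a Q : ℝ≥0∞) ^ p * (C * μ (E Q)) := by
          rw [haQ Q hQ h0]
          gcongr
          exact hcar Q hQ
      _ = C * ∫⁻ _ in E Q, (a Q : ℝ≥0∞) ^ p ∂μ := by
          rw [setLIntegral_const, mul_left_comm]
      _ ≤ C * ∫⁻ x in E Q, (finsetMaximal S a x : ℝ≥0∞) ^ p ∂μ := by
          gcongr C * ?_
          refine setLIntegral_mono' (hEmeas Q hQ) fun x hx => ?_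
          gcongr
          exact le_finsetMaximal hQ (hEsub Q hQ hx)
  calc ∑ Q ∈ S, ((∫⁻ x in Q, f x ∂μ) / μ Q) ^ p * μ Q
      ≤ ∑ Q ∈ S, C * ∫⁻ x in E Q, (finsetMaximal S a x : ℝ≥0∞) ^ p ∂μ :=
        Finset.sum_le_sum hterm
    _ = C * ∫⁻ x in ⋃ Q ∈ S, E Q, (finsetMaximal S a x : ℝ≥0∞) ^ p ∂μ := by
        rw [← Finset.mul_sum, lintegral_biUnion_finset hEdisj hEmeas]
    _ ≤ C * ∫⁻ x, (finsetMaximal S a x : ℝ≥0∞) ^ p ∂μ := by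
        gcongr
        exact Measure.restrict_le_self
    _ ≤ C * (ENNReal.ofReal ((p / (p - 1)) ^ p) * ∫⁻ x, f x ^ p ∂μ) := by
        gcongr
        exact lintegral_rpow_le_of_mul_measure_le_setLIntegral μ hf
          (measurable_finsetMaximal hmeas) hp
          (lintegral_finsetMaximal_rpow_ne_top hmeas hfin hp0) hweak
    _ = C * ENNReal.ofReal ((p / (p - 1)) ^ p) * ∫⁻ x, f x ^ p ∂μ := (mul_assoc _ _ _).symm

/-- Carleson-embedding estimate for principal cubes. -/
theorem principal_cubes_carleson (n : ℕ) (σ : Measure (Fin n → ℝ))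
    [IsLocallyFiniteMeasure σ] (p : ℝ) (hp : 1 < p)
    (f : (Fin n → ℝ) → ℝ≥0∞) (hf : Measurable f)
    (𝓕 : Set (Set (Fin n → ℝ))) (h𝓕 : ∀ F ∈ 𝓕, IsDyadicCube n F)
    (E : Set (Fin n → ℝ) → Set (Fin n → ℝ))
    (hEsub : ∀ F ∈ 𝓕, E F ⊆ F) (hEmeas : ∀ F ∈ 𝓕, MeasurableSet (E F))
    (hEdisj : 𝓕.PairwiseDisjoint E) (hcar : ∀ F ∈ 𝓕, σ F ≤ 2 * σ (E F)) :
    ∑' F : 𝓕, ((∫⁻ x in (F : Set (Fin n → ℝ)), f x ∂σ) / σ (F : Set (Fin n → ℝ))) ^ p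
        * σ (F : Set (Fin n → ℝ)) ≤
      2 * ENNReal.ofReal ((p / (p - 1)) ^ p) * ∫⁻ x, f x ^ p ∂σ := by
  rcases eq_or_ne (∫⁻ x, f x ^ p ∂σ) ∞ with hfp | hfp
  · have hpos : 0 < (p / (p - 1)) ^ p :=
      Real.rpow_pos_of_pos (div_pos (by linarith) (by linarith)) _
    rw [hfp, ENNReal.mul_top (mul_ne_zero two_ne_zero (ENNReal.ofReal_pos.2 hpos).ne')]
    exact le_top
  refine ENNReal.summable.tsum_le_of_sum_le fun s => ?_
  have hs : ∀ Q ∈ s.map (Function.Embedding.subtype (· ∈ 𝓕)), Q ∈ 𝓕 := by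
    intro Q hQ
    obtain ⟨R, -, rfl⟩ := Finset.mem_map.1 hQ
    exact R.2
  have hsum := sum_average_rpow_mul_measure_le σ hp hf hfp
    (s.map (Function.Embedding.subtype (· ∈ 𝓕)))
    (fun Q hQ => (h𝓕 Q (hs Q hQ)).measurableSet)
    (fun Q hQ => ((h𝓕 Q (hs Q hQ)).measure_lt_top σ).ne)
    (fun Q hQ R hR => (h𝓕 Q (hs Q hQ)).subset_or_subset_or_disjoint (h𝓕 R (hs R hR)))
    E (fun Q hQ => hEsub Q (hs Q hQ)) (fun Q hQ => hEmeas Q (hs Q hQ))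
    (hEdisj.subset fun Q hQ => hs Q hQ) (fun Q hQ => hcar Q (hs Q hQ))
  rwa [Finset.sum_map] at hsum

end
end

section
/- Let σ, ω be nonnegative locally finite Borel measures on ℝ^n, K : D → [0,∞), 1 < q < p < ∞, and 1/q = 1/r + 1/p. Suppose ‖(W^q_{K,ω}[σ])^{1/q}‖_{L^r(dσ)} ≤ C_2 and ‖(W^{p'}_{K,σ}[ω])^{1/p'}‖_{L^r(dω)} ≤ C_2, where W^s_{K,μ}[ν](x) = ∑_{Q ∈ D} K(Q) μ(Q) (∫_Q K̄_μ(Q)(y) dν(y))^{s-1} 1_Q(x) and K̄_μ(Q)(x) = (1/μ(Q)) ∑_{Q' ⊆ Q} K(Q') μ(Q') 1_{Q'}(x). Then for all nonnegative f ∈ L^p(dσ) and g ∈ L^{q'}(dω), ∑_{Q ∈ D} K(Q) (∫_Q f dσ)(∫_Q g dω) ≤ C(p,q) C_2 ‖f‖_{L^p(dσ)} ‖g‖_{L^{q'}(dω)}, i.e., the positive dyadic operator T_K[f dσ] = ∑_Q K(Q)(∫_Q f dσ) 1_Q satisfies ‖T_K[f dσ]‖_{L^q(dω)} ≤ C(p,q)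 C_2 ‖f‖_{L^p(dσ)}. -/
open MeasureTheory ENNReal Classical

noncomputable section

/-- The dyadic cube indexed by a pair `(i, k)`. -/
def cube (n : ℕ) (P : ℤ × (Fin n → ℤ)) : Set (Fin n → ℝ) := dyadicCube n P.1 P.2

/-- `K̄_μ(Q)(x) = (1/μ(Q)) ∑_{Q' ⊆ Q} K(Q') μ(Q') 1_{Q'}(x)` (zero when `μ(Q) = 0`,
by `ℝ≥0∞`-division conventions together with multiplication by `K(Q)μ(Q)` below). -/
def Kbar (n : ℕ) (K : ℤ × (Fin n → ℤ) → ℝ≥0∞) (μ : Measure (Fin n → ℝ))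
    (P : ℤ × (Fin n → ℤ)) (x : Fin n → ℝ) : ℝ≥0∞ :=
  (∑' P' : ℤ × (Fin n → ℤ),
    if cube n P' ⊆ cube n P then (cube n P').indicator (fun _ => K P' * μ (cube n P')) x
    else 0) / μ (cube n P)

/-- The discrete Wolff potential
`W^s_{K,μ}[ν](x) = ∑_Q K(Q) μ(Q) (∫_Q K̄_μ(Q) dν)^{s-1} 1_Q(x)`. -/
def wolff (n : ℕ) (K : ℤ × (Fin n → ℤ) → ℝ≥0∞) (μ ν : Measure (Fin n → ℝ))
    (s : ℝ) (x : Fin n → ℝ) : ℝ≥0∞ :=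
  ∑' P : ℤ × (Fin n → ℤ), (cube n P).indicator
    (fun _ => K P * μ (cube n P) * (∫⁻ y in cube n P, Kbar n K μ P y ∂ν) ^ (s - 1)) x

/-- A family of nonempty sets, indexed by a partial order compatible with inclusion, in which any
two members are nested or disjoint. -/
structure IsLaminar {ι X : Type*} [PartialOrder ι] (c : ι → Set X) : Prop where
  mono : Monotone c
  nonempty : ∀ i, (c i).Nonempty
  comparable : ∀ i j x, x ∈ c i → x ∈ c j → i ≤ j ∨ j ≤ i

/-- The increment of `φ` at `i` over its values at the strictly larger members of `S`. -/
def increment {ι : Type*} [PartialOrder ι] (S : Finset ι) (φ : ι → ℝ≥0∞) (i : ι) : ℝ≥0∞ :=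
  φ i - (S.filter (i < ·)).sup φ

/-- The running supremum of `φ` over the members of `S` above `i`. -/
def runningSup {ι : Type*} [PartialOrder ι] (S : Finset ι) (φ : ι → ℝ≥0∞) (i : ι) : ℝ≥0∞ :=
  (S.filter (i ≤ ·)).sup φ

section Combinatorics

variable {ι X : Type*} [PartialOrder ι]

theorem sum_increment_eq_sup (S : Finset ι) {φ : ι → ℝ≥0∞} (hφ : Antitone φ) (T : Finset ι)
    (hTS : T ⊆ S) (hup : ∀ j ∈ T, ∀ k ∈ S, j ≤ k → k ∈ T)
    (hchain : ∀ j ∈ T, ∀ k ∈ T, j ≤ k ∨ k ≤ j) :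
    ∑ j ∈ T, increment S φ j = T.sup φ := by
  induction T using Finset.strongInduction with
  | H T ih =>
    rcases T.eq_empty_or_nonempty with rfl | hne
    · simp
    · obtain ⟨m, hm⟩ := Finset.exists_minimal hne
      have hmT : m ∈ T := hm.1
      have hleast : ∀ j ∈ T, m ≤ j := fun j hj =>
        (hchain m hmT j hj).elim id (fun h => hm.2 hj h)
      have herase : T.erase m = S.filter (m < ·) := by
        ext k
        simp only [Finset.mem_erase, Finset.mem_filter]
        constructor
        · rintro ⟨hk, hkT⟩
          exact ⟨hTS hkT, lt_of_le_of_ne (hleast k hkT) (Ne.symm hk)⟩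
        · rintro ⟨hkS, hk⟩
          exact ⟨hk.ne', hup m hmT k hkS hk.le⟩
      have hrec := ih (T.erase m) (Finset.erase_ssubset hmT)
        ((Finset.erase_subset _ _).trans hTS)
        (fun j hj k hk hjk => by
          have hj' := Finset.mem_erase.1 hj
          refine Finset.mem_erase.2 ⟨?_, hup j hj'.2 k hk hjk⟩
          rintro rfl
          exact hj'.1 (le_antisymm hjk (hleast j hj'.2)))
        (fun j hj k hk => hchain j (Finset.mem_of_mem_erase hj) k (Finset.mem_of_mem_erase hk))
      rw [← Finset.add_sum_erase T _ hmT, hrec, ← Finset.insert_erase hmT, Finset.sup_insert,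
        Finset.erase_insert (Finset.notMem_erase m T), herase]
      have hle : (S.filter (m < ·)).sup φ ≤ φ m :=
        Finset.sup_le fun k hk => hφ (Finset.mem_filter.1 hk).2.le
      rw [sup_eq_left.2 hle, increment, tsub_add_cancel_of_le hle]

theorem sum_increment_above {c : ι → Set X} (hc : IsLaminar c) (S : Finset ι)
    {φ : ι → ℝ≥0∞} (hφ : Antitone φ) {i : ι} (hi : i ∈ S) :
    ∑ j ∈ S with i ≤ j, increment S φ j = φ i := by
  rw [sum_increment_eq_sup S hφ _ (Finset.filter_subset _ _)]
  · exact le_antisymm (Finset.sup_le fun k hk => hφ (Finset.mem_filter.1 hk).2)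
      (Finset.le_sup (Finset.mem_filter.2 ⟨hi, le_rfl⟩))
  · intro j hj k hk hjk
    exact Finset.mem_filter.2 ⟨hk, (Finset.mem_filter.1 hj).2.trans hjk⟩
  · intro j hj k hk
    obtain ⟨x, hx⟩ := hc.nonempty i
    exact hc.comparable j k x (hc.mono (Finset.mem_filter.1 hj).2 hx)
      (hc.mono (Finset.mem_filter.1 hk).2 hx)

theorem sum_increment_containing {c : ι → Set X} (hc : IsLaminar c) (S : Finset ι)
    {φ : ι → ℝ≥0∞} (hφ : Antitone φ) (x : X) :
    ∑ j ∈ S with x ∈ c j, increment S φ j = (S.filter (x ∈ c ·)).sup φ := by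
  rw [sum_increment_eq_sup S hφ _ (Finset.filter_subset _ _)]
  · intro j hj k hk hjk
    exact Finset.mem_filter.2 ⟨hk, hc.mono hjk (Finset.mem_filter.1 hj).2⟩
  · intro j hj k hk
    exact hc.comparable j k x (Finset.mem_filter.1 hj).2 (Finset.mem_filter.1 hk).2

/-- The product of two sums over the members above `i` is controlled by its two triangular
parts, because these members form a chain. -/
theorem sum_above_mul_sum_above_le {c : ι → Set X} (hc : IsLaminar c) (S : Finset ι)
    (u v U V : ι → ℝ≥0∞) (hU : ∀ i ∈ S, ∑ j ∈ S with i ≤ j, u j = U i)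
    (hV : ∀ i ∈ S, ∑ j ∈ S with i ≤ j, v j = V i) {i : ι} (hi : i ∈ S) :
    U i * V i ≤ ∑ j ∈ S with i ≤ j, (U j * v j + V j * u j) := by
  obtain ⟨x, hx⟩ := hc.nonempty i
  set T := S.filter (i ≤ ·)
  have hT : ∀ j ∈ T, j ∈ S ∧ i ≤ j := fun j hj => Finset.mem_filter.1 hj
  have habove : ∀ j ∈ T, ∀ w : ι → ℝ≥0∞,
      (∑ k ∈ T, if j ≤ k then w k else 0) = ∑ k ∈ S with j ≤ k, w k := fun j hj w => by
    rw [← Finset.sum_filter, Finset.filter_filter]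
    refine Finset.sum_congr (Finset.filter_congr fun k _ => ?_) fun _ _ => rfl
    exact ⟨And.right, fun h => ⟨(hT j hj).2.trans h, h⟩⟩
  calc U i * V i = ∑ j ∈ T, ∑ k ∈ T, u j * v k := by
        rw [← hU i hi, ← hV i hi, Finset.sum_mul_sum]
    _ ≤ ∑ j ∈ T, ∑ k ∈ T,
          ((if k ≤ j then u j else 0) * v k + (if j ≤ k then v k else 0) * u j) := by
        refine Finset.sum_le_sum fun j hj => Finset.sum_le_sum fun k hk => ?_
        rcases hc.comparable j k x (hc.mono (hT j hj).2 hx) (hc.mono (hT k hk).2 hx) with h | h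
        · rw [if_pos h, mul_comm]
          exact le_add_self
        · rw [if_pos h]
          exact le_self_add
    _ = ∑ j ∈ T, (U j * v j + V j * u j) := by
        simp_rw [Finset.sum_add_distrib]
        congr 1
        · rw [Finset.sum_comm]
          refine Finset.sum_congr rfl fun k hk => ?_
          rw [← Finset.sum_mul, habove k hk, hU k (hT k hk).1]
        · refine Finset.sum_congr rfl fun j hj => ?_
          rw [← Finset.sum_mul, habove j hj, hV j (hT j hj).1]

theorem runningSup_antitone (S : Finset ι) (φ : ι → ℝ≥0∞) : Antitone (runningSup S φ) := by
  intro i j hij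
  refine Finset.sup_mono fun k hk => ?_
  rw [Finset.mem_filter] at hk ⊢
  exact ⟨hk.1, hij.trans hk.2⟩

theorem le_runningSup {S : Finset ι} (φ : ι → ℝ≥0∞) {i : ι} (hi : i ∈ S) :
    φ i ≤ runningSup S φ i :=
  Finset.le_sup (f := φ) (Finset.mem_filter.2 ⟨hi, le_rfl⟩)

theorem runningSup_ne_top {S : Finset ι} {φ : ι → ℝ≥0∞} (h : ∀ i ∈ S, φ i ≠ ⊤) (i : ι) :
    runningSup S φ i ≠ ⊤ := by
  rw [runningSup, ← lt_top_iff_ne_top, Finset.sup_lt_iff (by simp)]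
  exact fun k hk => (h k (Finset.mem_filter.1 hk).1).lt_top

/-- Where the running supremum strictly increases, it is attained by the function itself. -/
theorem runningSup_eq_of_sup_lt {S : Finset ι} (φ : ι → ℝ≥0∞) {i : ι} (hi : i ∈ S)
    (h : (S.filter (i < ·)).sup (runningSup S φ) < runningSup S φ i) :
    runningSup S φ i = φ i := by
  obtain ⟨k, hk, hk'⟩ := Finset.exists_mem_eq_sup (S.filter (i ≤ ·))
    ⟨i, Finset.mem_filter.2 ⟨hi, le_rfl⟩⟩ φ
  rw [Finset.mem_filter] at hk
  rcases hk.2.eq_or_lt with rfl | hlt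
  · exact hk'
  · have h1 : runningSup S φ i ≤ runningSup S φ k := by
      rw [runningSup, hk']
      exact le_runningSup φ hk.1
    have h2 : runningSup S φ k ≤ (S.filter (i < ·)).sup (runningSup S φ) :=
      Finset.le_sup (Finset.mem_filter.2 ⟨hk.1, hlt⟩)
    exact absurd h (not_lt.2 (h1.trans h2))

theorem sum_measure_maximal_le [MeasurableSpace X] {c : ι → Set X} (hc : IsLaminar c)
    (hmeas : ∀ i, MeasurableSet (c i)) (μ : Measure X) (B : Finset ι) {i : ι}
    (hB : ∀ j ∈ B, j ≤ i) :
    ∑ j ∈ B with Maximal (· ∈ B) j, μ (c j) ≤ μ (c i) := by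
  rw [← measure_biUnion_finset _ (fun j _ => hmeas j)]
  · exact measure_mono (Set.iUnion₂_subset fun j hj => hc.mono (hB j (Finset.mem_filter.1 hj).1))
  · intro j hj k hk hjk
    have hj' := (Finset.mem_filter.1 hj).2
    have hk' := (Finset.mem_filter.1 hk).2
    refine Set.disjoint_left.2 fun x hxj hxk => hjk ?_
    rcases hc.comparable j k x hxj hxk with h | h
    · exact le_antisymm h (hj'.2 hk'.1 h)
    · exact le_antisymm (hk'.2 hj'.1 h) h

/-- A bound of Cascante-Ortega-Verbitsky type for nested sums over a laminar family. -/
theorem sum_below_rpow_le [MeasurableSpace X] {c : ι → Set X} (hc : IsLaminar c)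
    (hmeas : ∀ i, MeasurableSet (c i)) (μ : Measure X) (S : Finset ι)
    (hμ0 : ∀ i ∈ S, μ (c i) ≠ 0) (hμt : ∀ i ∈ S, μ (c i) ≠ ⊤)
    (b D : ι → ℝ≥0∞) (hb : ∀ i ∈ S, b i ≠ ⊤) (hD : ∀ i, D i = ∑ j ∈ S with j ≤ i, b j)
    {q : ℝ} (hq : 1 < q) {i : ι} (hi : i ∈ S) :
    μ (c i) * (D i / μ (c i)) ^ q ≤
      2 ^ q * ∑ j ∈ S with j ≤ i, b j * (D j / μ (c j)) ^ (q - 1) := by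
  set P : ι → Prop := fun j => 2 * (D j / μ (c j)) < D i / μ (c i)
  set L := S.filter (· ≤ i)
  set B := L.filter P
  have hDt : ∀ j, D j ≠ ⊤ := fun j => by
    rw [hD]
    exact ENNReal.sum_ne_top.2 fun k hk => hb k (Finset.mem_filter.1 hk).1
  have hcover : ∑ j ∈ B, b j ≤ ∑ k ∈ B with Maximal (· ∈ B) k, D k := by
    simp_rw [hD]
    calc ∑ j ∈ B, b j ≤ ∑ j ∈ B, ∑ k ∈ B with Maximal (· ∈ B) k, if j ≤ k then b j else 0 := by
          refine Finset.sum_le_sum fun j hj => ?_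
          obtain ⟨k, hjk, hk⟩ := Finset.exists_le_maximal B hj
          calc b j = if j ≤ k then b j else 0 := by simp [hjk]
            _ ≤ _ := Finset.single_le_sum (f := fun k => if j ≤ k then b j else 0)
              (fun _ _ => zero_le) (Finset.mem_filter.2 ⟨hk.1, hk⟩)
      _ = ∑ k ∈ B with Maximal (· ∈ B) k, ∑ j ∈ B, if j ≤ k then b j else 0 := Finset.sum_comm
      _ ≤ _ := by
          refine Finset.sum_le_sum fun k _ => ?_
          rw [← Finset.sum_filter]
          refine Finset.sum_le_sum_of_subset fun j hj => ?_
          simp only [B, L, Finset.mem_filter] at hj ⊢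
          exact ⟨hj.1.1.1, hj.2⟩
  have hbad : 2 * ∑ j ∈ B, b j ≤ D i := by
    calc 2 * ∑ j ∈ B, b j ≤ 2 * ∑ k ∈ B with Maximal (· ∈ B) k, D k := by gcongr
      _ = ∑ k ∈ B with Maximal (· ∈ B) k, 2 * (D k / μ (c k)) * μ (c k) := by
          rw [Finset.mul_sum]
          refine Finset.sum_congr rfl fun k hk => ?_
          have hkS : k ∈ S := by
            simp only [B, L, Finset.mem_filter] at hk
            exact hk.1.1.1
          rw [mul_assoc, ENNReal.div_mul_cancel (hμ0 k hkS) (hμt k hkS)]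
      _ ≤ ∑ k ∈ B with Maximal (· ∈ B) k, D i / μ (c i) * μ (c k) := by
          refine Finset.sum_le_sum fun k hk => ?_
          have : P k := (Finset.mem_filter.1 (Finset.mem_filter.1 hk).1).2
          exact mul_le_mul_left this.le _
      _ ≤ D i / μ (c i) * μ (c i) := by
          rw [← Finset.mul_sum]
          gcongr
          exact sum_measure_maximal_le hc hmeas μ B fun j hj =>
            (Finset.mem_filter.1 (Finset.mem_filter.1 hj).1).2
      _ = D i := ENNReal.div_mul_cancel (hμ0 i hi) (hμt i hi)
  have hsplit : D i = ∑ j ∈ B, b j + ∑ j ∈ L with ¬ P j, b j :=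
    (hD i).trans (Finset.sum_filter_add_sum_filter_not L P b).symm
  have hBt : ∑ j ∈ B, b j ≠ ⊤ := fun h => hDt i (by rw [hsplit, h, top_add])
  have hgood : D i ≤ 2 * ∑ j ∈ L with ¬ P j, b j := by
    have h1 : ∑ j ∈ B, b j ≤ ∑ j ∈ L with ¬ P j, b j := by
      rw [two_mul, hsplit] at hbad
      exact (ENNReal.add_le_add_iff_left hBt).1 hbad
    calc D i = ∑ j ∈ B, b j + ∑ j ∈ L with ¬ P j, b j := hsplit
      _ ≤ _ := by rw [two_mul]; gcongr
  have hpow : ∀ x : ℝ≥0∞, x ^ q = x * x ^ (q - 1) := fun x => by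
    conv_rhs => rw [← ENNReal.rpow_one x, ← ENNReal.rpow_mul, one_mul,
      ← ENNReal.rpow_add_of_nonneg _ _ zero_le_one (by linarith)]
    congr 1; ring
  calc μ (c i) * (D i / μ (c i)) ^ q = D i * (D i / μ (c i)) ^ (q - 1) := by
        rw [hpow, ← mul_assoc, ENNReal.mul_div_cancel (hμ0 i hi) (hμt i hi)]
    _ ≤ (2 * ∑ j ∈ L with ¬ P j, b j) * (D i / μ (c i)) ^ (q - 1) := by gcongr
    _ = 2 * ∑ j ∈ L with ¬ P j, b j * (D i / μ (c i)) ^ (q - 1) := by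
        rw [mul_assoc, Finset.sum_mul]
    _ ≤ 2 * ∑ j ∈ L with ¬ P j, b j * (2 * (D j / μ (c j))) ^ (q - 1) := by
        refine mul_le_mul_right (Finset.sum_le_sum fun j hj => mul_le_mul_right
          (ENNReal.rpow_le_rpow (not_lt.1 (Finset.mem_filter.1 hj).2) (by linarith)) _) _
    _ = 2 ^ q * ∑ j ∈ L with ¬ P j, b j * (D j / μ (c j)) ^ (q - 1) := by
        rw [hpow 2, mul_assoc, Finset.mul_sum (a := 2 ^ (q - 1))]
        congr 1
        refine Finset.sum_congr rfl fun j _ => ?_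
        rw [ENNReal.mul_rpow_of_nonneg _ _ (by linarith)]
        ring
    _ ≤ _ := by
        gcongr
        exact Finset.filter_subset _ _

end Combinatorics

theorem rpow_le_rpow_of_exponent_nonpos {x y : ℝ≥0∞} (h : x ≤ y) {z : ℝ} (hz : z ≤ 0) :
    y ^ z ≤ x ^ z := by
  obtain ⟨w, rfl⟩ : ∃ w, z = -w := ⟨-z, by ring⟩
  rw [ENNReal.rpow_neg, ENNReal.rpow_neg, ENNReal.inv_le_inv]
  exact ENNReal.rpow_le_rpow h (by linarith)

section BilinearSum

variable {ι X : Type*} [PartialOrder ι] [MeasurableSpace X] {c : ι → Set X}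

theorem sum_below_mul_rpow_le (hc : IsLaminar c) (hmeas : ∀ i, MeasurableSet (c i))
    (μ : Measure X) (S : Finset ι) (hμ0 : ∀ i ∈ S, μ (c i) ≠ 0) (hμt : ∀ i ∈ S, μ (c i) ≠ ⊤)
    (a A b D F G dG : ι → ℝ≥0∞) (ha : ∀ i ∈ S, a i ≠ ⊤) (hF : Antitone F) (hG : Antitone G)
    (hF0 : ∀ i ∈ S, F i ≠ 0) (hFt : ∀ i ∈ S, F i ≠ ⊤)
    (hG0 : ∀ i ∈ S, G i ≠ 0) (hGt : ∀ i ∈ S, G i ≠ ⊤)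
    {p q q' : ℝ} (hp : 1 < p) (hq : q.HolderConjugate q')
    (hdG : ∀ i ∈ S, ∑ j ∈ S with i ≤ j, dG j = G i ^ q')
    (hA : ∀ i, A i = ∑ j ∈ S with j ≤ i, a j)
    (hb : ∀ i, b i = a i * (F i ^ (1 - p) * G i ^ (1 - q')))
    (hD : ∀ i, D i = ∑ j ∈ S with j ≤ i, b j) :
    ∑ j ∈ S, D j * (F j ^ p * dG j) ≤
      2 * (∑ j ∈ S, μ (c j) * dG j) ^ (1 / q') *
        (∑ i ∈ S, a i * (A i / μ (c i)) ^ (q - 1) * F i ^ q) ^ (1 / q) := by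
  have hq1 : 1 < q := hq.lt
  have hq'1 : 1 < q' := hq.symm.lt
  have hqq : (1 - q') * q + q' = 0 := by
    have := hq.mul_eq_add
    linarith
  have hbt : ∀ i ∈ S, b i ≠ ⊤ := fun i hi => by
    rw [hb]
    exact ENNReal.mul_ne_top (ha i hi) (ENNReal.mul_ne_top
      (ENNReal.rpow_ne_top_of_ne_zero (hF0 i hi) (hFt i hi))
      (ENNReal.rpow_ne_top_of_ne_zero (hG0 i hi) (hGt i hi)))
  have hDA : ∀ i, D i ≤ F i ^ (1 - p) * G i ^ (1 - q') * A i := fun i => by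
    rw [hD, hA, Finset.mul_sum]
    refine Finset.sum_le_sum fun j hj => ?_
    have hji := (Finset.mem_filter.1 hj).2
    rw [hb, mul_comm]
    gcongr ?_ * ?_ * _
    · exact rpow_le_rpow_of_exponent_nonpos (hF hji) (by linarith)
    · exact rpow_le_rpow_of_exponent_nonpos (hG hji) (by linarith)
  have hterm : ∀ i ∈ S, b i * (D i / μ (c i)) ^ (q - 1) * (F i ^ (p * q) * G i ^ q') ≤
      a i * (A i / μ (c i)) ^ (q - 1) * F i ^ q := fun i hi => by
    set w := F i ^ (1 - p) * G i ^ (1 - q') with hw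
    have hw0 : w ≠ 0 := mul_ne_zero
      (ENNReal.rpow_pos (hF0 i hi).bot_lt (hFt i hi)).ne'
      (ENNReal.rpow_pos (hG0 i hi).bot_lt (hGt i hi)).ne'
    have hwt : w ≠ ⊤ := ENNReal.mul_ne_top
      (ENNReal.rpow_ne_top_of_ne_zero (hF0 i hi) (hFt i hi))
      (ENNReal.rpow_ne_top_of_ne_zero (hG0 i hi) (hGt i hi))
    have hwq : w * w ^ (q - 1) * (F i ^ (p * q) * G i ^ q') = F i ^ q := by
      have h1 : w * w ^ (q - 1) = w ^ q := by
        conv_lhs => enter [1]; rw [← ENNReal.rpow_one w]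
        rw [← ENNReal.rpow_add _ _ hw0 hwt]
        congr 1; ring
      rw [h1, hw, ENNReal.mul_rpow_of_nonneg _ _ (by linarith), ← ENNReal.rpow_mul,
        ← ENNReal.rpow_mul, mul_mul_mul_comm, ← ENNReal.rpow_add _ _ (hF0 i hi) (hFt i hi),
        ← ENNReal.rpow_add _ _ (hG0 i hi) (hGt i hi), hqq, ENNReal.rpow_zero, mul_one]
      congr 1; ring
    calc b i * (D i / μ (c i)) ^ (q - 1) * (F i ^ (p * q) * G i ^ q')
        ≤ a i * w * (w * (A i / μ (c i))) ^ (q - 1) * (F i ^ (p * q) * G i ^ q') := by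
          rw [hb, ← hw, ← mul_div_assoc]
          gcongr
          exact hDA i
      _ = a i * (A i / μ (c i)) ^ (q - 1) * (w * w ^ (q - 1) * (F i ^ (p * q) * G i ^ q')) := by
          rw [ENNReal.mul_rpow_of_nonneg _ _ (by linarith)]
          ring
      _ = _ := by rw [hwq]
  have hsecond : ∑ j ∈ S, μ (c j) * dG j * (D j / μ (c j) * F j ^ p) ^ q ≤
      2 ^ q * ∑ i ∈ S, a i * (A i / μ (c i)) ^ (q - 1) * F i ^ q := by
    calc ∑ j ∈ S, μ (c j) * dG j * (D j / μ (c j) * F j ^ p) ^ q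
        = ∑ j ∈ S, dG j * F j ^ (p * q) * (μ (c j) * (D j / μ (c j)) ^ q) := by
          refine Finset.sum_congr rfl fun j _ => ?_
          rw [ENNReal.mul_rpow_of_nonneg _ _ (by linarith), ← ENNReal.rpow_mul]
          ring
      _ ≤ ∑ j ∈ S, dG j * F j ^ (p * q) *
            (2 ^ q * ∑ i ∈ S with i ≤ j, b i * (D i / μ (c i)) ^ (q - 1)) := by
          refine Finset.sum_le_sum fun j hj => mul_le_mul_right ?_ _
          exact sum_below_rpow_le hc hmeas μ S hμ0 hμt b D hbt hD hq1 hj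
      _ = 2 ^ q * ∑ j ∈ S, ∑ i ∈ S with i ≤ j,
            b i * (D i / μ (c i)) ^ (q - 1) * (dG j * F j ^ (p * q)) := by
          rw [Finset.mul_sum]
          refine Finset.sum_congr rfl fun j _ => ?_
          rw [mul_left_comm, Finset.mul_sum]
          congr 1
          exact Finset.sum_congr rfl fun i _ => mul_comm _ _
      _ = 2 ^ q * ∑ i ∈ S, ∑ j ∈ S with i ≤ j,
            b i * (D i / μ (c i)) ^ (q - 1) * (dG j * F j ^ (p * q)) := by
          congr 1
          refine Finset.sum_comm' fun j i => ?_
          simp only [Finset.mem_filter]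
          tauto
      _ ≤ 2 ^ q * ∑ i ∈ S, ∑ j ∈ S with i ≤ j,
            b i * (D i / μ (c i)) ^ (q - 1) * (dG j * F i ^ (p * q)) := by
          refine mul_le_mul_right (Finset.sum_le_sum fun i _ => Finset.sum_le_sum fun j hj =>
            mul_le_mul_right (mul_le_mul_right (ENNReal.rpow_le_rpow
              (hF (Finset.mem_filter.1 hj).2) (by positivity)) _) _) _
      _ = 2 ^ q * ∑ i ∈ S, b i * (D i / μ (c i)) ^ (q - 1) * (F i ^ (p * q) * G i ^ q') := by
          congr 1
          refine Finset.sum_congr rfl fun i hi => ?_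
          rw [← Finset.mul_sum, ← Finset.sum_mul, hdG i hi, mul_comm (G i ^ q')]
      _ ≤ _ := mul_le_mul_right (Finset.sum_le_sum hterm) _
  have hsum : 1 / q + 1 / q' = 1 := by
    have := hq.inv_add_inv_eq_one
    rwa [one_div, one_div]
  calc ∑ j ∈ S, D j * (F j ^ p * dG j)
      = ∑ j ∈ S, (μ (c j) * dG j) ^ (1 / q') *
          ((μ (c j) * dG j) ^ (1 / q) * (D j / μ (c j) * F j ^ p)) := by
        refine Finset.sum_congr rfl fun j hj => ?_
        rw [← mul_assoc ((μ (c j) * dG j) ^ (1 / q')),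
          ← ENNReal.rpow_add_of_nonneg _ _ (by positivity) (by positivity), add_comm, hsum,
          ENNReal.rpow_one]
        calc D j * (F j ^ p * dG j)
            = μ (c j) * (D j / μ (c j)) * (F j ^ p * dG j) := by
              rw [ENNReal.mul_div_cancel (hμ0 j hj) (hμt j hj)]
          _ = _ := by ring
    _ ≤ (∑ j ∈ S, ((μ (c j) * dG j) ^ (1 / q')) ^ q') ^ (1 / q') *
          (∑ j ∈ S, ((μ (c j) * dG j) ^ (1 / q) * (D j / μ (c j) * F j ^ p)) ^ q) ^ (1 / q) :=
        ENNReal.inner_le_Lp_mul_Lq _ _ _ hq.symm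
    _ = (∑ j ∈ S, μ (c j) * dG j) ^ (1 / q') *
          (∑ j ∈ S, μ (c j) * dG j * (D j / μ (c j) * F j ^ p) ^ q) ^ (1 / q) := by
        congr 2
        · refine Finset.sum_congr rfl fun j _ => ?_
          rw [← ENNReal.rpow_mul, one_div_mul_cancel (by linarith), ENNReal.rpow_one]
        · refine Finset.sum_congr rfl fun j _ => ?_
          rw [ENNReal.mul_rpow_of_nonneg _ _ (by linarith), ← ENNReal.rpow_mul,
            one_div_mul_cancel (by linarith), ENNReal.rpow_one]
    _ ≤ (∑ j ∈ S, μ (c j) * dG j) ^ (1 / q') *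
          (2 ^ q * ∑ i ∈ S, a i * (A i / μ (c i)) ^ (q - 1) * F i ^ q) ^ (1 / q) := by
        gcongr
    _ = _ := by
        rw [ENNReal.mul_rpow_of_nonneg _ _ (by positivity), ← ENNReal.rpow_mul,
          mul_one_div_cancel (by linarith), ENNReal.rpow_one]
        ring

/-- A bilinear sum over a laminar family, bounded by two single-weight sums. -/
theorem sum_mul_mul_le (hc : IsLaminar c) (hmeas : ∀ i, MeasurableSet (c i))
    (σ ω : Measure X) (S : Finset ι)
    (hσ0 : ∀ i ∈ S, σ (c i) ≠ 0) (hσt : ∀ i ∈ S, σ (c i) ≠ ⊤)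
    (hω0 : ∀ i ∈ S, ω (c i) ≠ 0) (hωt : ∀ i ∈ S, ω (c i) ≠ ⊤)
    (a A F G dF dG : ι → ℝ≥0∞) (ha : ∀ i ∈ S, a i ≠ ⊤) (hF : Antitone F) (hG : Antitone G)
    (hF0 : ∀ i ∈ S, F i ≠ 0) (hFt : ∀ i ∈ S, F i ≠ ⊤)
    (hG0 : ∀ i ∈ S, G i ≠ 0) (hGt : ∀ i ∈ S, G i ≠ ⊤)
    {p p' q q' : ℝ} (hp : p.HolderConjugate p') (hq : q.HolderConjugate q')
    (hdF : ∀ i ∈ S, ∑ j ∈ S with i ≤ j, dF j = F i ^ p)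
    (hdG : ∀ i ∈ S, ∑ j ∈ S with i ≤ j, dG j = G i ^ q')
    (hA : ∀ i, A i = ∑ j ∈ S with j ≤ i, a j) :
    ∑ i ∈ S, a i * F i * G i ≤
      2 * (∑ j ∈ S, ω (c j) * dG j) ^ (1 / q') *
        (∑ i ∈ S, a i * (A i / ω (c i)) ^ (q - 1) * F i ^ q) ^ (1 / q) +
      2 * (∑ j ∈ S, σ (c j) * dF j) ^ (1 / p) *
        (∑ i ∈ S, a i * (A i / σ (c i)) ^ (p' - 1) * G i ^ p') ^ (1 / p') := by
  set b : ι → ℝ≥0∞ := fun i => a i * (F i ^ (1 - p) * G i ^ (1 - q')) with hb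
  set D : ι → ℝ≥0∞ := fun i => ∑ j ∈ S with j ≤ i, b j with hD
  have hone : ∀ x : ℝ≥0∞, x ≠ 0 → x ≠ ⊤ → ∀ z : ℝ, x ^ (1 - z) * x ^ z = x := by
    intro x h0 ht z
    rw [← ENNReal.rpow_add _ _ h0 ht, sub_add_cancel, ENNReal.rpow_one]
  calc ∑ i ∈ S, a i * F i * G i = ∑ i ∈ S, b i * (F i ^ p * G i ^ q') := by
        refine Finset.sum_congr rfl fun i hi => ?_
        calc a i * F i * G i = a i * (F i ^ (1 - p) * F i ^ p) * (G i ^ (1 - q') * G i ^ q') := by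
              rw [hone _ (hF0 i hi) (hFt i hi), hone _ (hG0 i hi) (hGt i hi)]
          _ = _ := by simp only [hb]; ring
    _ ≤ ∑ i ∈ S, b i * ∑ j ∈ S with i ≤ j, (F j ^ p * dG j + G j ^ q' * dF j) := by
        gcongr with i hi
        exact sum_above_mul_sum_above_le hc S dF dG _ _ hdF hdG hi
    _ = ∑ j ∈ S, ∑ i ∈ S with i ≤ j, b i * (F j ^ p * dG j + G j ^ q' * dF j) := by
        simp_rw [Finset.mul_sum]
        refine Finset.sum_comm' fun j i => ?_
        simp only [Finset.mem_filter]
        tauto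
    _ = ∑ j ∈ S, D j * (F j ^ p * dG j) + ∑ j ∈ S, D j * (G j ^ q' * dF j) := by
        rw [← Finset.sum_add_distrib]
        refine Finset.sum_congr rfl fun j _ => ?_
        rw [← Finset.sum_mul, mul_add]
    _ ≤ _ := by
        gcongr
        · exact sum_below_mul_rpow_le hc hmeas ω S hω0 hωt a A b D F G dG ha hF hG hF0 hFt hG0 hGt
            hp.lt hq hdG hA (fun _ => rfl) fun _ => rfl
        · exact sum_below_mul_rpow_le hc hmeas σ S hσ0 hσt a A b D G F dF ha hG hF hG0 hGt hF0 hFt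
            hq.symm.lt hp.symm hdF hA (fun _ => by rw [hb, mul_comm (G _ ^ _)]) fun _ => rfl

end BilinearSum

theorem rpow_sub_rpow_le {a b : ℝ≥0∞} (hab : a ≤ b) (hb : b ≠ ⊤) {p p' : ℝ}
    (hp : p.HolderConjugate p') :
    b ^ p - a ^ p ≤ ENNReal.ofReal p' * (b * (b ^ (p - 1) - a ^ (p - 1))) := by
  lift b to NNReal using hb
  lift a to NNReal using (hab.trans_lt ENNReal.coe_lt_top).ne
  have hp1 : 1 < p := hp.lt
  have hp0 : 0 ≤ p := by linarith
  have hp'0 : 0 < p' := hp.symm.pos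
  have hab' : a ≤ b := ENNReal.coe_le_coe.1 hab
  have hab1 : a ^ (p - 1) ≤ b ^ (p - 1) := NNReal.rpow_le_rpow hab' (by linarith)
  have hp1' : 0 ≤ p - 1 := by linarith
  have hyoung := Real.young_inequality_of_nonneg
    (Real.rpow_nonneg a.coe_nonneg (p - 1)) b.coe_nonneg hp.symm
  rw [← Real.rpow_mul a.coe_nonneg, hp.sub_one_mul_conj] at hyoung
  have hbp : (b : ℝ) * (b : ℝ) ^ (p - 1) = (b : ℝ) ^ p := by
    conv_lhs => enter [1]; rw [← Real.rpow_one (b : ℝ)]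
    rw [← Real.rpow_add_of_nonneg b.coe_nonneg zero_le_one hp1']
    congr 1; ring
  have hpp : p' / p = p' - 1 := by
    have := hp.mul_eq_add
    field_simp
    linarith
  rw [ENNReal.ofReal, ← ENNReal.coe_rpow_of_nonneg _ hp0, ← ENNReal.coe_rpow_of_nonneg _ hp0,
    ← ENNReal.coe_rpow_of_nonneg _ hp1', ← ENNReal.coe_rpow_of_nonneg _ hp1',
    ← ENNReal.coe_sub, ← ENNReal.coe_sub, ← ENNReal.coe_mul, ← ENNReal.coe_mul,
    ENNReal.coe_le_coe, tsub_le_iff_right, ← NNReal.coe_le_coe]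
  push_cast [NNReal.coe_sub hab1, Real.coe_toNNReal _ hp'0.le]
  have h1 : p' * ((a : ℝ) ^ (p - 1) * b) ≤ (a : ℝ) ^ p + (p' - 1) * (b : ℝ) ^ p := by
    calc p' * ((a : ℝ) ^ (p - 1) * b) ≤ p' * ((a : ℝ) ^ p / p' + (b : ℝ) ^ p / p) := by gcongr
      _ = (a : ℝ) ^ p + p' / p * (b : ℝ) ^ p := by field_simp
      _ = _ := by rw [hpp]
  calc (b : ℝ) ^ p
      ≤ p' * (b : ℝ) ^ p - p' * ((a : ℝ) ^ (p - 1) * b) + (a : ℝ) ^ p := by linarith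
    _ = _ := by rw [← hbp]; ring

theorem sup_rpow {ι : Type*} (T : Finset ι) (φ : ι → ℝ≥0∞) {z : ℝ} (hz : 0 < z) :
    (T.sup fun i => φ i ^ z) = T.sup φ ^ z :=
  (Finset.apply_sup_eq_sup_comp (· ^ z)
    (fun _ _ => (ENNReal.monotone_rpow_of_nonneg hz.le).map_sup _ _)
    (ENNReal.zero_rpow_of_pos hz)).symm

theorem lintegral_sum_indicator {ι X : Type*} [MeasurableSpace X] {c : ι → Set X}
    (hmeas : ∀ i, MeasurableSet (c i)) (μ : Measure X)
    (S : Finset ι) (d : ι → ℝ≥0∞) :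
    ∫⁻ x, ∑ j ∈ S, (c j).indicator (fun _ => d j) x ∂μ = ∑ j ∈ S, μ (c j) * d j := by
  rw [lintegral_finsetSum _ fun j _ => measurable_const.indicator (hmeas j)]
  refine Finset.sum_congr rfl fun j _ => ?_
  rw [lintegral_indicator_const (hmeas j), mul_comm]

theorem setLIntegral_sum_indicator_div {ι X : Type*} [MeasurableSpace X] {c : ι → Set X}
    (hmeas : ∀ i, MeasurableSet (c i)) (ν : Measure X) (T : Finset ι) (d : ι → ℝ≥0∞) {s : Set X}
    (hT : ∀ i ∈ T, c i ⊆ s) (m : ℝ≥0∞) :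
    ∫⁻ y in s, (∑ i ∈ T, (c i).indicator (fun _ => d i) y) / m ∂ν =
      (∑ i ∈ T, d i * ν (c i)) / m := by
  simp_rw [div_eq_mul_inv]
  rw [lintegral_mul_const _ (Finset.measurable_sum _ fun i _ =>
    measurable_const.indicator (hmeas i)), lintegral_sum_indicator hmeas]
  congr 1
  refine Finset.sum_congr rfl fun i hi => ?_
  rw [Measure.restrict_apply (hmeas i), Set.inter_eq_left.2 (hT i hi), mul_comm]

theorem sum_indicator_eq {ι X : Type*} {c : ι → Set X} (S : Finset ι) (d : ι → ℝ≥0∞) (x : X) :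
    ∑ j ∈ S, (c j).indicator (fun _ => d j) x = ∑ j ∈ S with x ∈ c j, d j := by
  simp_rw [Finset.sum_filter, Set.indicator_apply]

section Maximal

variable {ι X : Type*} [PartialOrder ι] [MeasurableSpace X] {c : ι → Set X}

theorem mul_increment_rpow_le (S : Finset ι) (φ : ι → ℝ≥0∞) (hφt : ∀ i ∈ S, φ i ≠ ⊤)
    {p p' : ℝ} (hp : p.HolderConjugate p') {i : ι} (hi : i ∈ S) :
    increment S (fun i => runningSup S φ i ^ p) i ≤
      ENNReal.ofReal p' * (φ i * increment S (fun i => runningSup S φ i ^ (p - 1)) i) := by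
  have hp1 : 0 < p - 1 := by linarith [hp.lt]
  rw [increment, increment, sup_rpow _ _ hp.pos, sup_rpow _ _ hp1]
  rcases le_or_gt (runningSup S φ i) ((S.filter (i < ·)).sup (runningSup S φ)) with h | h
  · rw [tsub_eq_zero_of_le (ENNReal.rpow_le_rpow h hp.nonneg)]
    exact zero_le
  · have hle := rpow_sub_rpow_le h.le (runningSup_ne_top hφt i) hp
    rwa [runningSup_eq_of_sup_lt φ hi h] at hle ⊢

/-- Doob's maximal inequality over a finite laminar family. -/
theorem sum_measure_mul_increment_le (hc : IsLaminar c) (hmeas : ∀ i, MeasurableSet (c i))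
    (μ : Measure X) (S : Finset ι) (hμt : ∀ i ∈ S, μ (c i) ≠ ⊤)
    {f : X → ℝ≥0∞} (hf : Measurable f) (φ : ι → ℝ≥0∞) (hφt : ∀ i ∈ S, φ i ≠ ⊤)
    (hφ : ∀ i ∈ S, μ (c i) * φ i = ∫⁻ x in c i, f x ∂μ)
    {p p' : ℝ} (hp : p.HolderConjugate p') :
    (∑ j ∈ S, μ (c j) * increment S (fun i => runningSup S φ i ^ p) j) ^ (1 / p) ≤
      ENNReal.ofReal p' * (∫⁻ x, f x ^ p ∂μ) ^ (1 / p) := by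
  have hp1 : 0 < p - 1 := by linarith [hp.lt]
  have hanti : ∀ z : ℝ, 0 ≤ z → Antitone fun i => runningSup S φ i ^ z := fun z hz i j hij =>
    ENNReal.rpow_le_rpow (runningSup_antitone S φ hij) hz
  set d := increment S (fun i => runningSup S φ i ^ p)
  set d' := increment S (fun i => runningSup S φ i ^ (p - 1))
  set I := ∑ j ∈ S, μ (c j) * d j with hI
  have hIt : I ≠ ⊤ := ENNReal.sum_ne_top.2 fun j hj => ENNReal.mul_ne_top (hμt j hj)
    (ne_top_of_le_ne_top (ENNReal.rpow_ne_top_of_nonneg hp.nonneg (runningSup_ne_top hφt j))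
      tsub_le_self)
  set H : X → ℝ≥0∞ := fun x => ∑ j ∈ S, (c j).indicator (fun _ => d' j) x
  have hHmeas : Measurable H :=
    Finset.measurable_sum _ fun j _ => measurable_const.indicator (hmeas j)
  have hHpow : ∀ x, H x ^ p' = ∑ j ∈ S, (c j).indicator (fun _ => d j) x := fun x => by
    simp only [H, sum_indicator_eq, d, d']
    rw [sum_increment_containing hc S (hanti _ hp1.le) x,
      sum_increment_containing hc S (hanti _ hp.nonneg) x, sup_rpow _ _ hp1, sup_rpow _ _ hp.pos,
      ← ENNReal.rpow_mul, hp.sub_one_mul_conj]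
  have hbound : I ≤ ENNReal.ofReal p' * ((∫⁻ x, f x ^ p ∂μ) ^ (1 / p) * I ^ (1 / p')) := by
    calc I ≤ ∑ j ∈ S, ENNReal.ofReal p' * ∫⁻ x, f x * (c j).indicator (fun _ => d' j) x ∂μ := by
          refine Finset.sum_le_sum fun j hj => ?_
          calc μ (c j) * d j ≤ μ (c j) * (ENNReal.ofReal p' * (φ j * d' j)) := by
                gcongr
                exact mul_increment_rpow_le S φ hφt hp hj
            _ = ENNReal.ofReal p' * ((μ (c j) * φ j) * d' j) := by ring
            _ = _ := by
                rw [hφ j hj, ← lintegral_mul_const _ hf, ← lintegral_indicator (hmeas j)]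
                congr 2
                ext x
                by_cases hx : x ∈ c j <;> simp [hx]
      _ = ENNReal.ofReal p' * ∫⁻ x, (f * H) x ∂μ := by
          simp only [H, Pi.mul_apply, Finset.mul_sum]
          have hfd : ∀ j ∈ S, Measurable fun x => f x * (c j).indicator (fun _ => d' j) x :=
            fun j _ => hf.mul (measurable_const.indicator (hmeas j))
          rw [lintegral_finsetSum _ hfd, Finset.mul_sum]
      _ ≤ ENNReal.ofReal p' *
            ((∫⁻ x, f x ^ p ∂μ) ^ (1 / p) * (∫⁻ x, H x ^ p' ∂μ) ^ (1 / p')) := by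
          gcongr
          exact ENNReal.lintegral_mul_le_Lp_mul_Lq μ hp hf.aemeasurable hHmeas.aemeasurable
      _ = _ := by simp_rw [hHpow, lintegral_sum_indicator hmeas, hI]
  rcases eq_or_ne I 0 with h0 | h0
  · rw [h0, ENNReal.zero_rpow_of_pos (by have := hp.pos; positivity)]
    exact zero_le
  · have hne0 : I ^ (1 / p') ≠ 0 := (ENNReal.rpow_pos h0.bot_lt hIt).ne'
    have hnet : I ^ (1 / p') ≠ ⊤ := ENNReal.rpow_ne_top_of_ne_zero h0 hIt
    have hsplit : I = I ^ (1 / p') * I ^ (1 / p) := by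
      rw [← ENNReal.rpow_add _ _ h0 hIt, one_div, one_div, add_comm, hp.inv_add_inv_eq_one,
        ENNReal.rpow_one]
    refine (ENNReal.mul_le_mul_iff_right hne0 hnet).1 ?_
    rw [← hsplit]
    refine hbound.trans_eq ?_
    ring

theorem sum_testing_le (hmeas : ∀ i, MeasurableSet (c i)) (hmono : Monotone c)
    (μ : Measure X) (S : Finset ι) (k F dF : ι → ℝ≥0∞) (W : X → ℝ≥0∞)
    (hW : ∀ x, ∑ i ∈ S, (c i).indicator (fun _ => k i) x ≤ W x)
    {p q r : ℝ} (hp : 0 < p) (hq : 0 < q) (hqp : q < p) (hr : 1 / q = 1 / r + 1 / p) {M : ℝ≥0∞}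
    (hM : (∫⁻ x, W x ^ (r / q) ∂μ) ^ (1 / r) ≤ M)
    (hdF : ∀ i ∈ S, ∑ j ∈ S with i ≤ j, dF j = F i ^ p) :
    (∑ i ∈ S, μ (c i) * (k i * F i ^ q)) ^ (1 / q) ≤
      M * (∑ j ∈ S, μ (c j) * dF j) ^ (1 / p) := by
  have hr0 : 0 < r := by
    have : 1 / p < 1 / q := one_div_lt_one_div_of_lt hq hqp
    exact one_div_pos.1 (by linarith)
  have hconj : (r / q).HolderConjugate (p / q) := by
    rw [Real.holderConjugate_iff]
    constructor
    · rw [lt_div_iff₀ hq, one_mul]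
      refine lt_of_one_div_lt_one_div hr0 ?_
      have : 0 < 1 / p := by positivity
      linarith
    · rw [inv_div, inv_div, div_eq_mul_one_div, div_eq_mul_one_div q p, ← mul_add, ← hr,
        mul_one_div_cancel hq.ne']
  set V : X → ℝ≥0∞ := fun x => ∑ i ∈ S, (c i).indicator (fun _ => k i) x
  set H : X → ℝ≥0∞ := fun x => ∑ j ∈ S, (c j).indicator (fun _ => dF j) x
  have hVmeas : Measurable V :=
    Finset.measurable_sum _ fun j _ => measurable_const.indicator (hmeas j)
  have hHmeas : Measurable H :=
    Finset.measurable_sum _ fun j _ => measurable_const.indicator (hmeas j)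
  have hFH : ∀ i ∈ S, ∀ x ∈ c i, F i ^ q ≤ H x ^ (q / p) := fun i hi x hx => by
    calc F i ^ q = (F i ^ p) ^ (q / p) := by
          rw [← ENNReal.rpow_mul, mul_div_cancel₀ _ hp.ne']
      _ ≤ _ := by
          gcongr
          simp only [H, ← hdF i hi, sum_indicator_eq]
          refine Finset.sum_le_sum_of_subset fun j hj => ?_
          rw [Finset.mem_filter] at hj ⊢
          exact ⟨hj.1, hmono hj.2 hx⟩
  have hmain : ∑ i ∈ S, μ (c i) * (k i * F i ^ q) ≤
      (∫⁻ x, W x ^ (r / q) ∂μ) ^ (q / r) * (∑ j ∈ S, μ (c j) * dF j) ^ (q / p) := by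
    calc ∑ i ∈ S, μ (c i) * (k i * F i ^ q)
        = ∫⁻ x, ∑ i ∈ S, (c i).indicator (fun _ => k i * F i ^ q) x ∂μ :=
          (lintegral_sum_indicator hmeas μ S _).symm
      _ ≤ ∫⁻ x, (V * fun x => H x ^ (q / p)) x ∂μ := by
          refine lintegral_mono fun x => ?_
          simp only [V, Pi.mul_apply, Finset.sum_mul]
          refine Finset.sum_le_sum fun i hi => ?_
          by_cases hx : x ∈ c i
          · simp only [Set.indicator_of_mem hx]
            gcongr
            exact hFH i hi x hx
          · simp [hx]
      _ ≤ (∫⁻ x, V x ^ (r / q) ∂μ) ^ (1 / (r / q)) *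
            (∫⁻ x, (H x ^ (q / p)) ^ (p / q) ∂μ) ^ (1 / (p / q)) :=
          ENNReal.lintegral_mul_le_Lp_mul_Lq μ hconj hVmeas.aemeasurable
            (hHmeas.pow_const _).aemeasurable
      _ ≤ _ := by
          have hqp1 : q / p * (p / q) = 1 := by field_simp
          simp_rw [← ENNReal.rpow_mul, hqp1, ENNReal.rpow_one, one_div_div, H,
            lintegral_sum_indicator hmeas]
          gcongr with x
          exact hW x
  calc (∑ i ∈ S, μ (c i) * (k i * F i ^ q)) ^ (1 / q)
      ≤ ((∫⁻ x, W x ^ (r / q) ∂μ) ^ (q / r) *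
          (∑ j ∈ S, μ (c j) * dF j) ^ (q / p)) ^ (1 / q) := by gcongr
    _ = (∫⁻ x, W x ^ (r / q) ∂μ) ^ (1 / r) * (∑ j ∈ S, μ (c j) * dF j) ^ (1 / p) := by
        rw [ENNReal.mul_rpow_of_nonneg _ _ (by positivity), ← ENNReal.rpow_mul,
          ← ENNReal.rpow_mul]
        congr 2 <;> field_simp
    _ ≤ _ := by gcongr

end Maximal

/-- The bilinear estimate for a finite laminar family, under testing conditions given by majorants
`U` and `W` of the two discrete Wolff potentials. -/
theorem sum_mul_lintegral_mul_lintegral_le {ι X : Type*} [PartialOrder ι] [MeasurableSpace X]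
    {c : ι → Set X} (hc : IsLaminar c) (hmeas : ∀ i, MeasurableSet (c i))
    (σ ω : Measure X) (S : Finset ι)
    (hσ0 : ∀ i ∈ S, σ (c i) ≠ 0) (hσt : ∀ i ∈ S, σ (c i) ≠ ⊤)
    (hω0 : ∀ i ∈ S, ω (c i) ≠ 0) (hωt : ∀ i ∈ S, ω (c i) ≠ ⊤)
    (k A : ι → ℝ≥0∞) (hk : ∀ i ∈ S, k i ≠ ⊤)
    (hA : ∀ i, A i = ∑ j ∈ S with j ≤ i, k j * σ (c j) * ω (c j))
    {p p' q q' r : ℝ} (hp : p.HolderConjugate p') (hq : q.HolderConjugate q') (hqp : q < p)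
    (hr : 1 / q = 1 / r + 1 / p) {U W : X → ℝ≥0∞}
    (hU : ∀ x, ∑ i ∈ S,
      (c i).indicator (fun _ => k i * ω (c i) * (A i / ω (c i)) ^ (q - 1)) x ≤ U x)
    (hW : ∀ x, ∑ i ∈ S,
      (c i).indicator (fun _ => k i * σ (c i) * (A i / σ (c i)) ^ (p' - 1)) x ≤ W x)
    {M : ℝ≥0∞} (hMU : (∫⁻ x, U x ^ (r / q) ∂σ) ^ (1 / r) ≤ M)
    (hMW : (∫⁻ x, W x ^ (r / p') ∂ω) ^ (1 / r) ≤ M)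
    {f g : X → ℝ≥0∞} (hf : Measurable f) (hg : Measurable g)
    (hf0 : ∀ i ∈ S, ∫⁻ x in c i, f x ∂σ ≠ 0) (hft : ∀ i ∈ S, ∫⁻ x in c i, f x ∂σ ≠ ⊤)
    (hg0 : ∀ i ∈ S, ∫⁻ x in c i, g x ∂ω ≠ 0) (hgt : ∀ i ∈ S, ∫⁻ x in c i, g x ∂ω ≠ ⊤) :
    ∑ i ∈ S, k i * (∫⁻ x in c i, f x ∂σ) * (∫⁻ x in c i, g x ∂ω) ≤
      4 * ENNReal.ofReal p' * ENNReal.ofReal q * M * (∫⁻ x, f x ^ p ∂σ) ^ (1 / p) *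
        (∫⁻ x, g x ^ q' ∂ω) ^ (1 / q') := by
  have hanti : ∀ φ : ι → ℝ≥0∞, ∀ z : ℝ, 0 ≤ z → Antitone fun i => runningSup S φ i ^ z :=
    fun φ z hz i j hij => ENNReal.rpow_le_rpow (runningSup_antitone S φ hij) hz
  set a : ι → ℝ≥0∞ := fun i => k i * σ (c i) * ω (c i) with ha
  set φ : ι → ℝ≥0∞ := fun i => (∫⁻ x in c i, f x ∂σ) / σ (c i) with hφ
  set γ : ι → ℝ≥0∞ := fun i => (∫⁻ x in c i, g x ∂ω) / ω (c i) with hγ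
  set F := runningSup S φ
  set G := runningSup S γ
  set dF := increment S (fun i => F i ^ p)
  set dG := increment S (fun i => G i ^ q')
  have hφt : ∀ i ∈ S, φ i ≠ ⊤ := fun i hi => ENNReal.div_ne_top (hft i hi) (hσ0 i hi)
  have hγt : ∀ i ∈ S, γ i ≠ ⊤ := fun i hi => ENNReal.div_ne_top (hgt i hi) (hω0 i hi)
  have hF0 : ∀ i ∈ S, F i ≠ 0 := fun i hi =>
    ((ENNReal.div_pos (hf0 i hi) (hσt i hi)).trans_le (le_runningSup φ hi)).ne'
  have hG0 : ∀ i ∈ S, G i ≠ 0 := fun i hi =>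
    ((ENNReal.div_pos (hg0 i hi) (hωt i hi)).trans_le (le_runningSup γ hi)).ne'
  have hφmul : ∀ i ∈ S, σ (c i) * φ i = ∫⁻ x in c i, f x ∂σ := fun i hi =>
    ENNReal.mul_div_cancel (hσ0 i hi) (hσt i hi)
  have hγmul : ∀ i ∈ S, ω (c i) * γ i = ∫⁻ x in c i, g x ∂ω := fun i hi =>
    ENNReal.mul_div_cancel (hω0 i hi) (hωt i hi)
  have hdF : ∀ i ∈ S, ∑ j ∈ S with i ≤ j, dF j = F i ^ p := fun i hi =>
    sum_increment_above hc S (hanti φ p hp.nonneg) hi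
  have hdG : ∀ i ∈ S, ∑ j ∈ S with i ≤ j, dG j = G i ^ q' := fun i hi =>
    sum_increment_above hc S (hanti γ q' hq.symm.nonneg) hi
  have hFbound := sum_measure_mul_increment_le hc hmeas σ S hσt hf φ hφt hφmul hp
  have hGbound := sum_measure_mul_increment_le hc hmeas ω S hωt hg γ hγt hγmul hq.symm
  have hp' : 1 - 1 / p = 1 / p' := by
    rw [one_div, one_div]; linarith [hp.inv_add_inv_eq_one]
  have hq' : 1 - 1 / q = 1 / q' := by
    rw [one_div, one_div]; linarith [hq.inv_add_inv_eq_one]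
  have hp'q' : p' < q' := by
    refine lt_of_one_div_lt_one_div hq.symm.pos ?_
    rw [← hp', ← hq']
    linarith [one_div_lt_one_div_of_lt hq.pos hqp]
  have htestF := sum_testing_le hmeas hc.mono σ S _ F dF U hU hp.pos hq.pos hqp hr hMU hdF
  have htestG := sum_testing_le hmeas hc.mono ω S _ G dG W hW hq.symm.pos hp.symm.pos hp'q'
    (by rw [← hp', ← hq']; linarith) hMW hdG
  have hsumF : ∑ i ∈ S, a i * (A i / ω (c i)) ^ (q - 1) * F i ^ q =
      ∑ i ∈ S, σ (c i) * (k i * ω (c i) * (A i / ω (c i)) ^ (q - 1) * F i ^ q) :=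
    Finset.sum_congr rfl fun i _ => by simp only [ha]; ring
  have hsumG : ∑ i ∈ S, a i * (A i / σ (c i)) ^ (p' - 1) * G i ^ p' =
      ∑ i ∈ S, ω (c i) * (k i * σ (c i) * (A i / σ (c i)) ^ (p' - 1) * G i ^ p') :=
    Finset.sum_congr rfl fun i _ => by simp only [ha]; ring
  calc ∑ i ∈ S, k i * (∫⁻ x in c i, f x ∂σ) * (∫⁻ x in c i, g x ∂ω)
      = ∑ i ∈ S, a i * φ i * γ i := by
        refine Finset.sum_congr rfl fun i hi => ?_
        rw [← hφmul i hi, ← hγmul i hi]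
        simp only [ha]
        ring
    _ ≤ ∑ i ∈ S, a i * F i * G i := by
        gcongr with i hi
        · exact le_runningSup φ hi
        · exact le_runningSup γ hi
    _ ≤ _ := sum_mul_mul_le hc hmeas σ ω S hσ0 hσt hω0 hωt a A F G dF dG
        (fun i hi => ENNReal.mul_ne_top (ENNReal.mul_ne_top (hk i hi) (hσt i hi)) (hωt i hi))
        (runningSup_antitone S φ) (runningSup_antitone S γ)
        hF0 (fun i _ => runningSup_ne_top hφt i) hG0 (fun i _ => runningSup_ne_top hγt i)
        hp hq hdF hdG hA
    _ ≤ 2 * (∑ j ∈ S, ω (c j) * dG j) ^ (1 / q') * (M * (∑ j ∈ S, σ (c j) * dF j) ^ (1 / p)) +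
          2 * (∑ j ∈ S, σ (c j) * dF j) ^ (1 / p) *
            (M * (∑ j ∈ S, ω (c j) * dG j) ^ (1 / q')) := by
        rw [hsumF, hsumG]
        gcongr
    _ = 4 * M * ((∑ j ∈ S, σ (c j) * dF j) ^ (1 / p) * (∑ j ∈ S, ω (c j) * dG j) ^ (1 / q')) := by
        ring
    _ ≤ 4 * M * ((ENNReal.ofReal p' * (∫⁻ x, f x ^ p ∂σ) ^ (1 / p)) *
          (ENNReal.ofReal q * (∫⁻ x, g x ^ q' ∂ω) ^ (1 / q'))) := by gcongr
    _ = _ := by ring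

section Dyadic

variable {n : ℕ}

theorem mem_cube_iff {P : ℤ × (Fin n → ℤ)} {x : Fin n → ℝ} :
    x ∈ cube n P ↔ ∀ j, ⌊x j * 2 ^ P.1⌋ = P.2 j := by
  refine forall_congr' fun j => ?_
  have h2 : (0 : ℝ) < 2 ^ P.1 := by positivity
  rw [Int.floor_eq_iff, zpow_neg, ← div_eq_mul_inv, ← div_eq_mul_inv, div_le_iff₀ h2,
    lt_div_iff₀ h2]

theorem cube_nonempty (P : ℤ × (Fin n → ℤ)) : (cube n P).Nonempty := by
  refine ⟨fun j => P.2 j / 2 ^ P.1, mem_cube_iff.2 fun j => ?_⟩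
  rw [div_mul_cancel₀ _ (by positivity), Int.floor_intCast]

theorem cube_subset_of_mem {P Q : ℤ × (Fin n → ℤ)} (h : Q.1 ≤ P.1) {x : Fin n → ℝ}
    (hP : x ∈ cube n P) (hQ : x ∈ cube n Q) : cube n P ⊆ cube n Q := by
  obtain ⟨m, hm⟩ := Int.le.dest h
  have hfloor : ∀ a b : ℝ, ⌊a * 2 ^ P.1⌋ ≤ ⌊b * 2 ^ P.1⌋ → ⌊a * 2 ^ Q.1⌋ ≤ ⌊b * 2 ^ Q.1⌋ := by
    intro a b hab
    have hscale : ∀ t : ℝ, t * 2 ^ P.1 = t * 2 ^ Q.1 * 2 ^ m := fun t => by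
      rw [← hm, zpow_add₀ two_ne_zero, zpow_natCast, mul_assoc]
    have h2 : (0 : ℝ) < 2 ^ m := by positivity
    have h1 : ⌊a * 2 ^ Q.1⌋ * 2 ^ m ≤ ⌊a * 2 ^ P.1⌋ := by
      rw [Int.le_floor, hscale]
      push_cast
      exact mul_le_mul_of_nonneg_right (Int.floor_le _) h2.le
    have h3 := Int.le_floor.1 (h1.trans hab)
    rw [hscale] at h3
    push_cast at h3
    exact Int.le_floor.2 (le_of_mul_le_mul_right h3 h2)
  intro y hy
  rw [mem_cube_iff] at *
  intro j
  rw [← hQ j]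
  have heq : ⌊y j * 2 ^ P.1⌋ = ⌊x j * 2 ^ P.1⌋ := (hy j).trans (hP j).symm
  exact le_antisymm (hfloor _ _ heq.le) (hfloor _ _ heq.ge)

theorem measurableSet_cube (P : ℤ × (Fin n → ℤ)) : MeasurableSet (cube n P) := by
  have : cube n P = ⋂ j, {x | (P.2 j : ℝ) * 2 ^ (-P.1) ≤ x j} ∩
      {x | x j < ((P.2 j : ℝ) + 1) * 2 ^ (-P.1)} := by
    ext x
    simp [cube, dyadicCube]
  rw [this]
  exact MeasurableSet.iInter fun j =>
    (measurableSet_le measurable_const (measurable_pi_apply j)).inter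
      (measurableSet_lt (measurable_pi_apply j) measurable_const)

theorem measure_cube_ne_top (μ : Measure (Fin n → ℝ)) [IsLocallyFiniteMeasure μ]
    (P : ℤ × (Fin n → ℤ)) : μ (cube n P) ≠ ⊤ := by
  refine ne_top_of_le_ne_top (isCompact_Icc (a := fun j => (P.2 j : ℝ) * 2 ^ (-P.1))
    (b := fun j => ((P.2 j : ℝ) + 1) * 2 ^ (-P.1))).measure_lt_top.ne (measure_mono ?_)
  exact fun x hx => ⟨fun j => (hx j).1, fun j => (hx j).2.le⟩

/-- Indices of dyadic cubes, ordered by inclusion of cubes and by generation. -/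
def DyadicIndex (n : ℕ) : Type := ℤ × (Fin n → ℤ)

instance : PartialOrder (DyadicIndex n) where
  le P Q := Q.1 ≤ P.1 ∧ cube n P ⊆ cube n Q
  le_refl P := ⟨le_rfl, subset_rfl⟩
  le_trans P Q R hPQ hQR := ⟨hQR.1.trans hPQ.1, hPQ.2.trans hQR.2⟩
  le_antisymm P Q hPQ hQP := by
    have h1 : P.1 = Q.1 := le_antisymm hQP.1 hPQ.1
    obtain ⟨x, hx⟩ := cube_nonempty P
    refine Prod.ext h1 (funext fun j => ?_)
    rw [← mem_cube_iff.1 hx j, h1, mem_cube_iff.1 (hPQ.2 hx) j]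

theorem isLaminar_cube : IsLaminar (ι := DyadicIndex n) (cube n) where
  mono _ _ h := h.2
  nonempty := cube_nonempty
  comparable P Q x hP hQ := by
    rcases le_total Q.1 P.1 with h | h
    · exact Or.inl ⟨h, cube_subset_of_mem h hP hQ⟩
    · exact Or.inr ⟨h, cube_subset_of_mem h hQ hP⟩

theorem sum_div_le_lintegral_Kbar (K k : DyadicIndex n → ℝ≥0∞) (hkK : ∀ P, k P ≤ K P)
    (μ ν : Measure (Fin n → ℝ)) (S : Finset (DyadicIndex n)) (P : DyadicIndex n) :
    (∑ Q ∈ S with Q ≤ P, k Q * μ (cube n Q) * ν (cube n Q)) / μ (cube n P) ≤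
      ∫⁻ y in cube n P, Kbar n K μ P y ∂ν := by
  set T := S.filter (· ≤ P)
  have hT : ∀ Q ∈ T, cube n Q ⊆ cube n P := fun Q hQ => (Finset.mem_filter.1 hQ).2.2
  calc (∑ Q ∈ T, k Q * μ (cube n Q) * ν (cube n Q)) / μ (cube n P)
      = ∫⁻ y in cube n P, (∑ Q ∈ T, (cube n Q).indicator (fun _ => k Q * μ (cube n Q)) y) /
          μ (cube n P) ∂ν :=
        (setLIntegral_sum_indicator_div (c := cube n) measurableSet_cube ν T _ hT _).symm
    _ ≤ _ := by
        refine lintegral_mono fun y => ENNReal.div_le_div_right ?_ _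
        calc ∑ Q ∈ T, (cube n Q).indicator (fun _ => k Q * μ (cube n Q)) y
            ≤ ∑ Q ∈ T, if cube n Q ⊆ cube n P then
                (cube n Q).indicator (fun _ => K Q * μ (cube n Q)) y else 0 := by
              refine Finset.sum_le_sum fun Q hQ => ?_
              rw [if_pos (hT Q hQ)]
              exact Set.indicator_le_indicator (mul_le_mul_left (hkK Q) _)
          _ ≤ _ := ENNReal.sum_le_tsum T

theorem sum_indicator_le_wolff (K k : DyadicIndex n → ℝ≥0∞) (hkK : ∀ P, k P ≤ K P)
    (μ ν : Measure (Fin n → ℝ)) (S : Finset (DyadicIndex n)) {s : ℝ} (hs : 1 ≤ s)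
    (A : DyadicIndex n → ℝ≥0∞)
    (hA : ∀ P, A P = ∑ Q ∈ S with Q ≤ P, k Q * μ (cube n Q) * ν (cube n Q)) (x : Fin n → ℝ) :
    ∑ P ∈ S, (cube n P).indicator
      (fun _ => k P * μ (cube n P) * (A P / μ (cube n P)) ^ (s - 1)) x ≤ wolff n K μ ν s x := by
  refine le_trans (Finset.sum_le_sum fun P _ => ?_) (ENNReal.sum_le_tsum S)
  refine Set.indicator_le_indicator (mul_le_mul' (mul_le_mul_left (hkK P) _)
    (ENNReal.rpow_le_rpow ?_ (by linarith)))
  rw [hA]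
  exact sum_div_le_lintegral_Kbar K k hkK μ ν S P

end Dyadic

theorem setLIntegral_ne_top_of_rpow {X : Type*} [MeasurableSpace X] (μ : Measure X) {s : Set X}
    (hs : μ s ≠ ⊤) {f : X → ℝ≥0∞} (hf : Measurable f) {p p' : ℝ} (hp : p.HolderConjugate p')
    (hfp : (∫⁻ x, f x ^ p ∂μ) ^ (1 / p) ≠ ⊤) : ∫⁻ x in s, f x ∂μ ≠ ⊤ := by
  have hholder := ENNReal.lintegral_mul_le_Lp_mul_Lq (μ.restrict s) hp hf.aemeasurable
    (aemeasurable_const (b := (1 : ℝ≥0∞)))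
  simp only [Pi.mul_apply, mul_one, ENNReal.one_rpow, lintegral_one, Measure.restrict_apply_univ]
    at hholder
  refine ne_top_of_le_ne_top (ENNReal.mul_ne_top (ne_top_of_le_ne_top hfp ?_) ?_) hholder
  · exact ENNReal.rpow_le_rpow (setLIntegral_le_lintegral _ _) (one_div_nonneg.2 hp.nonneg)
  · exact ENNReal.rpow_ne_top_of_nonneg (one_div_nonneg.2 hp.symm.nonneg) hs

theorem setLIntegral_eq_zero_of_rpow {X : Type*} [MeasurableSpace X] (μ : Measure X) (s : Set X)
    {f : X → ℝ≥0∞} (hf : Measurable f) {p : ℝ} (hp : 0 < p)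
    (hfp : (∫⁻ x, f x ^ p ∂μ) ^ (1 / p) = 0) : ∫⁻ x in s, f x ∂μ = 0 := by
  rw [ENNReal.rpow_eq_zero_iff_of_pos (by positivity),
    lintegral_eq_zero_iff (hf.pow_const p)] at hfp
  have hf0 : f =ᵐ[μ] 0 := by
    filter_upwards [hfp] with x hx
    exact (ENNReal.rpow_eq_zero_iff_of_pos hp).1 hx
  rw [lintegral_congr_ae (ae_restrict_of_ae hf0)]
  simp

theorem iSup_min_natCast (x : ℝ≥0∞) : ⨆ N : ℕ, min x N = x := by
  refine le_antisymm (iSup_le fun N => min_le_left _ _) ?_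
  rcases eq_or_ne x ⊤ with rfl | hx
  · simp [ENNReal.iSup_natCast]
  · obtain ⟨N, hN⟩ := ENNReal.exists_nat_gt hx
    exact le_iSup_of_le N (by rw [min_eq_left hN.le])

theorem tsum_bilinear_le_of_ne_top {n : ℕ} {p p' q q' r : ℝ}
    (hp : p.HolderConjugate p') (hq : q.HolderConjugate q') (hqp : q < p)
    (hr : 1 / q = 1 / r + 1 / p) (σ ω : Measure (Fin n → ℝ)) [IsLocallyFiniteMeasure σ]
    [IsLocallyFiniteMeasure ω] (K : ℤ × (Fin n → ℤ) → ℝ≥0∞) {M : ℝ≥0∞}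
    (hMσ : (∫⁻ x, wolff n K ω σ q x ^ (r / q) ∂σ) ^ (1 / r) ≤ M)
    (hMω : (∫⁻ x, wolff n K σ ω p' x ^ (r / p') ∂ω) ^ (1 / r) ≤ M)
    {f g : (Fin n → ℝ) → ℝ≥0∞} (hf : Measurable f) (hg : Measurable g)
    (hft : (∫⁻ x, f x ^ p ∂σ) ^ (1 / p) ≠ ⊤) (hgt : (∫⁻ x, g x ^ q' ∂ω) ^ (1 / q') ≠ ⊤) :
    ∑' P : ℤ × (Fin n → ℤ),
        K P * (∫⁻ y in cube n P, f y ∂σ) * (∫⁻ y in cube n P, g y ∂ω) ≤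
      4 * ENNReal.ofReal p' * ENNReal.ofReal q * M * (∫⁻ x, f x ^ p ∂σ) ^ (1 / p) *
        (∫⁻ x, g x ^ q' ∂ω) ^ (1 / q') := by
  have htrunc : ∀ P, K P * (∫⁻ y in cube n P, f y ∂σ) * (∫⁻ y in cube n P, g y ∂ω) =
      ⨆ N : ℕ, min (K P) N * (∫⁻ y in cube n P, f y ∂σ) * (∫⁻ y in cube n P, g y ∂ω) := by
    intro P
    rw [← ENNReal.iSup_mul, ← ENNReal.iSup_mul, iSup_min_natCast]
  rw [ENNReal.tsum_eq_iSup_sum]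
  refine iSup_le fun S => ?_
  simp_rw [htrunc]
  rw [ENNReal.finsetSum_iSup_of_monotone fun P N N' hN => by gcongr]
  refine iSup_le fun N => ?_
  set T : Finset (DyadicIndex n) := S.filter fun P =>
    (σ (cube n P) ≠ 0 ∧ ω (cube n P) ≠ 0) ∧
      ∫⁻ y in cube n P, f y ∂σ ≠ 0 ∧ ∫⁻ y in cube n P, g y ∂ω ≠ 0 with hTdef
  have hT : ∀ P ∈ T, (σ (cube n P) ≠ 0 ∧ ω (cube n P) ≠ 0) ∧
      ∫⁻ y in cube n P, f y ∂σ ≠ 0 ∧ ∫⁻ y in cube n P, g y ∂ω ≠ 0 := fun P hP =>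
    (Finset.mem_filter.1 hP).2
  have hST : ∑ P ∈ S, min (K P) N * (∫⁻ y in cube n P, f y ∂σ) * (∫⁻ y in cube n P, g y ∂ω) =
      ∑ P ∈ T, min (K P) N * (∫⁻ y in cube n P, f y ∂σ) * (∫⁻ y in cube n P, g y ∂ω) := by
    refine (Finset.sum_filter_of_ne fun P _ hne => ?_).symm
    have hf0 : ∫⁻ y in cube n P, f y ∂σ ≠ 0 := fun h => hne (by rw [h, mul_zero, zero_mul])
    have hg0 : ∫⁻ y in cube n P, g y ∂ω ≠ 0 := fun h => hne (by rw [h, mul_zero])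
    exact ⟨⟨fun h => hf0 (setLIntegral_measure_zero _ _ h),
      fun h => hg0 (setLIntegral_measure_zero _ _ h)⟩, hf0, hg0⟩
  rw [hST]
  exact sum_mul_lintegral_mul_lintegral_le isLaminar_cube measurableSet_cube σ ω T
    (fun P hP => (hT P hP).1.1) (fun P _ => measure_cube_ne_top σ P)
    (fun P hP => (hT P hP).1.2) (fun P _ => measure_cube_ne_top ω P)
    (fun P => min (K P) N)
    (fun P => ∑ Q ∈ T with Q ≤ P, min (K Q) N * σ (cube n Q) * ω (cube n Q))
    (fun P _ => ne_top_of_le_ne_top (ENNReal.natCast_ne_top N) (min_le_right _ _))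
    (fun _ => rfl) hp hq hqp hr
    (sum_indicator_le_wolff K _ (fun _ => min_le_left _ _) ω σ T hq.lt.le _ fun P =>
      Finset.sum_congr rfl fun Q _ => mul_right_comm _ _ _)
    (sum_indicator_le_wolff K _ (fun _ => min_le_left _ _) σ ω T hp.symm.lt.le _ fun _ => rfl)
    hMσ hMω hf hg (fun P hP => (hT P hP).2.1)
    (fun P _ => setLIntegral_ne_top_of_rpow σ (measure_cube_ne_top σ P) hf hp hft)
    (fun P hP => (hT P hP).2.2)
    (fun P _ => setLIntegral_ne_top_of_rpow ω (measure_cube_ne_top ω P) hg hq.symm hgt)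

/-- If the testing constant vanishes, so does every term of the bilinear sum. -/
theorem kernel_mul_eq_zero_of_wolff_eq_zero {n : ℕ} {p p' q q' r : ℝ}
    (hp : p.HolderConjugate p') (hq : q.HolderConjugate q') (hqp : q < p)
    (hr : 1 / q = 1 / r + 1 / p) (σ ω : Measure (Fin n → ℝ)) [IsLocallyFiniteMeasure σ]
    [IsLocallyFiniteMeasure ω] (K : ℤ × (Fin n → ℤ) → ℝ≥0∞)
    (hMσ : (∫⁻ x, wolff n K ω σ q x ^ (r / q) ∂σ) ^ (1 / r) ≤ 0)
    (hMω : (∫⁻ x, wolff n K σ ω p' x ^ (r / p') ∂ω) ^ (1 / r) ≤ 0)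
    (f g : (Fin n → ℝ) → ℝ≥0∞) (P : ℤ × (Fin n → ℤ)) :
    K P * (∫⁻ y in cube n P, f y ∂σ) * (∫⁻ y in cube n P, g y ∂ω) = 0 := by
  have hnorm : ∀ (μ : Measure (Fin n → ℝ)) [IsLocallyFiniteMeasure μ] (z : ℝ), 0 < z →
      (∫⁻ x, (cube n P).indicator (fun _ => (1 : ℝ≥0∞)) x ^ z ∂μ) ^ (1 / z) ≠ ⊤ := by
    intro μ _ z hz
    have hpow : ∀ x, (cube n P).indicator (fun _ => (1 : ℝ≥0∞)) x ^ z =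
        (cube n P).indicator (fun _ => 1) x := fun x => by
      by_cases hx : x ∈ cube n P <;> simp [hx, hz]
    simp_rw [hpow]
    rw [lintegral_indicator_const (measurableSet_cube P), one_mul]
    exact ENNReal.rpow_ne_top_of_nonneg (by positivity) (measure_cube_ne_top μ P)
  have hone : Measurable ((cube n P).indicator fun _ => (1 : ℝ≥0∞)) :=
    measurable_const.indicator (measurableSet_cube P)
  have hle := (ENNReal.le_tsum P).trans (tsum_bilinear_le_of_ne_top hp hq hqp hr σ ω K hMσ hMω
    hone hone (hnorm σ p hp.pos) (hnorm ω q' hq.symm.pos))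
  have hint : ∀ μ : Measure (Fin n → ℝ),
      ∫⁻ y in cube n P, (cube n P).indicator (fun _ => (1 : ℝ≥0∞)) y ∂μ = μ (cube n P) := by
    intro μ
    rw [lintegral_indicator_const (measurableSet_cube P), one_mul,
      Measure.restrict_apply_self]
  rw [hint, hint, mul_zero, zero_mul, zero_mul, nonpos_iff_eq_zero, mul_eq_zero, mul_eq_zero]
    at hle
  rcases hle with (h | h) | h
  · rw [h, zero_mul, zero_mul]
  · rw [setLIntegral_measure_zero _ _ h, mul_zero, zero_mul]
  · rw [setLIntegral_measure_zero _ _ h, mul_zero]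

/-- Sufficiency in the two weight trace theorem, upper triangle case `1 < q < p < ∞`
(bilinear form of `‖T_K[f dσ]‖_{L^q(dω)} ≤ C C₂ ‖f‖_{L^p(dσ)}`). -/
theorem trace_inequality_sufficiency (n : ℕ) (p q r : ℝ)
    (hq : 1 < q) (hqp : q < p) (hr : 1 / q = 1 / r + 1 / p) :
    ∃ C : ℝ≥0∞, 0 < C ∧ C < ⊤ ∧
      ∀ (σ ω : Measure (Fin n → ℝ)), IsLocallyFiniteMeasure σ →
        IsLocallyFiniteMeasure ω → ∀ (K : ℤ × (Fin n → ℤ) → ℝ≥0∞) (C₂ : ℝ≥0∞),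
        (∫⁻ x, wolff n K ω σ q x ^ (r / q) ∂σ) ^ (1 / r) ≤ C₂ →
        (∫⁻ x, wolff n K σ ω (p / (p - 1)) x ^ (r / (p / (p - 1))) ∂ω) ^ (1 / r) ≤ C₂ →
        ∀ f g : (Fin n → ℝ) → ℝ≥0∞, Measurable f → Measurable g →
          ∑' P : ℤ × (Fin n → ℤ),
              K P * (∫⁻ y in cube n P, f y ∂σ) * (∫⁻ y in cube n P, g y ∂ω) ≤
            C * C₂ * (∫⁻ x, f x ^ p ∂σ) ^ (1 / p) *
              (∫⁻ x, g x ^ (q / (q - 1)) ∂ω) ^ (1 / (q / (q - 1))) := by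
  have hp1 : 1 < p := hq.trans hqp
  have hp := Real.HolderConjugate.conjExponent hp1
  have hq' := Real.HolderConjugate.conjExponent hq
  rw [Real.conjExponent] at hp hq'
  have hC0 : 4 * ENNReal.ofReal (p / (p - 1)) * ENNReal.ofReal q ≠ 0 :=
    mul_ne_zero (mul_ne_zero four_ne_zero (ENNReal.ofReal_pos.2 hp.symm.pos).ne')
      (ENNReal.ofReal_pos.2 hq'.pos).ne'
  refine ⟨4 * ENNReal.ofReal (p / (p - 1)) * ENNReal.ofReal q, hC0.bot_lt,
    (ENNReal.mul_ne_top (ENNReal.mul_ne_top (by simp) ENNReal.ofReal_ne_top)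
      ENNReal.ofReal_ne_top).lt_top, ?_⟩
  intro σ ω _ _ K C₂ hσ hω f g hf hg
  rcases eq_or_ne C₂ 0 with rfl | hC₂
  · simp_rw [kernel_mul_eq_zero_of_wolff_eq_zero hp hq' hqp hr σ ω K hσ hω f g, tsum_zero]
    exact zero_le
  rcases eq_or_ne ((∫⁻ x, f x ^ p ∂σ) ^ (1 / p)) 0 with hf0 | hf0
  · simp_rw [setLIntegral_eq_zero_of_rpow σ _ hf hp.pos hf0, mul_zero, zero_mul, tsum_zero]
    exact zero_le
  rcases eq_or_ne ((∫⁻ x, g x ^ (q / (q - 1)) ∂ω) ^ (1 / (q / (q - 1)))) 0 with hg0 | hg0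
  · simp_rw [setLIntegral_eq_zero_of_rpow ω _ hg hq'.symm.pos hg0, mul_zero, tsum_zero]
    exact zero_le
  rcases eq_or_ne ((∫⁻ x, f x ^ p ∂σ) ^ (1 / p)) ⊤ with hft | hft
  · rw [hft, ENNReal.mul_top (mul_ne_zero hC0 hC₂), ENNReal.top_mul hg0]
    exact le_top
  rcases eq_or_ne ((∫⁻ x, g x ^ (q / (q - 1)) ∂ω) ^ (1 / (q / (q - 1)))) ⊤ with hgt | hgt
  · rw [hgt, ENNReal.mul_top (mul_ne_zero (mul_ne_zero hC0 hC₂) hf0)]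
    exact le_top
  exact tsum_bilinear_le_of_ne_top hp hq' hqp hr σ ω K hσ hω hf hg hft hgt

end
end
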